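/- arXiv:1207.0715 — 2 statements merged into one kernel-verified Lean document; each statement's English description precedes it below -/
import Mathlib

section
/- Let n ≥ 5, let α ∈ [2, n−3], and let E ⊂ ℝⁿ be a set of finite perimeter with |E| = |B_1|. Set f_E = χ_{B_1} − χ_E and φ_α(r) = (1/H^{n−1}(∂B_r)) ∫_{∂B_r} I_α f_E dH^{n−1}. If φ_α is nonincreasing on (0,∞), then (1/|B_1|) ∫_{B_1} I_α f_E(x) dx ≤ 2n(n+2) · (1/|B_1|) ∫_{B_1} I_{α+2} f_E(x) dx. -/
open MeasureTheory Metric Set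

noncomputable section

/-- The divergence of a vector field on `ℝⁿ`. -/
def vdiv {n : ℕ} (φ : EuclideanSpace ℝ (Fin n) → EuclideanSpace ℝ (Fin n))
    (x : EuclideanSpace ℝ (Fin n)) : ℝ :=
  ∑ i, fderiv ℝ φ x (EuclideanSpace.single i 1) i

/-- The set of admissible values `∫_F div φ` in the variational definition of the
perimeter: `φ` ranges over compactly supported `C¹` vector fields with `‖φ‖ ≤ 1`. -/
def perimVals {n : ℕ} (F : Set (EuclideanSpace ℝ (Fin n))) : Set ℝ :=
  { r | ∃ φ : EuclideanSpace ℝ (Fin n) → EuclideanSpace ℝ (Fin n),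
      ContDiff ℝ 1 φ ∧ HasCompactSupport φ ∧ (∀ x, ‖φ x‖ ≤ 1) ∧
      r = ∫ x in F, vdiv φ x }

/-- The (distributional) perimeter `P(F)`. -/
def perimeter {n : ℕ} (F : Set (EuclideanSpace ℝ (Fin n))) : ℝ := sSup (perimVals F)

/-- `F` is a set of finite perimeter: it is measurable and the variational
definition of the perimeter is finite. -/
def HasFinitePerimeter {n : ℕ} (F : Set (EuclideanSpace ℝ (Fin n))) : Prop :=
  MeasurableSet F ∧ BddAbove (perimVals F)

/-- The Newtonian interaction energy `NL(F) = ∫∫ χ_F(x)χ_F(y)|x-y|^{2-n}`. -/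
def NL {n : ℕ} (F : Set (EuclideanSpace ℝ (Fin n))) : ℝ :=
  ∫ x in F, ∫ y in F, ‖x - y‖ ^ (2 - (n : ℝ))

/-- The function `f_E = χ_{B_1} - χ_E`. -/
def fE {n : ℕ} (E : Set (EuclideanSpace ℝ (Fin n))) (x : EuclideanSpace ℝ (Fin n)) : ℝ :=
  (ball (0 : EuclideanSpace ℝ (Fin n)) 1).indicator 1 x - E.indicator 1 x

/-- The Newtonian potential `v(y) = ∫ (χ_{B_1} - χ_E)(x) |x-y|^{2-n} dx`. -/
def newtPot {n : ℕ} (E : Set (EuclideanSpace ℝ (Fin n))) (y : EuclideanSpace ℝ (Fin n)) : ℝ :=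
  ∫ x, fE E x * ‖x - y‖ ^ (2 - (n : ℝ))

/-- The normalization constant `σ_{n,α}` of the Riesz potential. -/
def rieszConst (n : ℕ) (α : ℝ) : ℝ :=
  (Real.pi ^ ((n : ℝ) / 2) * 2 ^ α * Real.Gamma (α / 2) / Real.Gamma (((n : ℝ) - α) / 2))⁻¹

/-- The Riesz potential `I_α f(x) = σ_{n,α} ∫ f(ξ)|x-ξ|^{α-n} dξ`. -/
def rieszPot {n : ℕ} (α : ℝ) (f : EuclideanSpace ℝ (Fin n) → ℝ)
    (x : EuclideanSpace ℝ (Fin n)) : ℝ :=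
  rieszConst n α * ∫ ξ, f ξ * ‖x - ξ‖ ^ (α - (n : ℝ))

/-- The average of `g` over the sphere `∂B_r` with respect to the
`(n-1)`-dimensional Hausdorff measure. -/
def sphAvg {n : ℕ} (g : EuclideanSpace ℝ (Fin n) → ℝ) (r : ℝ) : ℝ :=
  (μH[(n : ℝ) - 1] (sphere (0 : EuclideanSpace ℝ (Fin n)) r)).toReal⁻¹ *
    ∫ y in sphere (0 : EuclideanSpace ℝ (Fin n)) r, g y ∂μH[(n : ℝ) - 1]

/-- The average of `g` over the ball `B_r` with respect to the Lebesgue measure. -/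
def ballAvg {n : ℕ} (g : EuclideanSpace ℝ (Fin n) → ℝ) (r : ℝ) : ℝ :=
  (volume (ball (0 : EuclideanSpace ℝ (Fin n)) r)).toReal⁻¹ *
    ∫ x in ball (0 : EuclideanSpace ℝ (Fin n)) r, g x

end


set_option autoImplicit false
abbrev Eu (n : ℕ) := EuclideanSpace ℝ (Fin n)


lemma sph_fin_rank {n : ℕ} (v : Eu (n+1)) (hv : ‖v‖ = 1) :
    Module.finrank ℝ ((Submodule.span ℝ {v})ᗮ : Submodule ℝ (Eu (n+1))) = n := by
  have : Fact (Module.finrank ℝ (Eu (n+1)) = n + 1) := ⟨by simp⟩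
  exact Submodule.finrank_orthogonal_span_singleton (by intro h; simp [h] at hv)

lemma hemi_lt_top {n : ℕ} (v : Eu (n+1)) (hv : ‖v‖ = 1) :
    μH[(n : ℝ)] (sphere (0 : Eu (n+1)) 1 ∩ {x | inner ℝ v x ≤ 0}) < ⊤ := by
  set W : Submodule ℝ (Eu (n+1)) := (Submodule.span ℝ {v})ᗮ with hW
  have hr := sph_fin_rank v hv
  have hH : (μH[(n : ℝ)] : Measure W) (closedBall 0 2) < ⊤ := by
    have := (isAddHaarMeasure_hausdorffMeasure (E := W)).lt_top_of_isCompact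
      (K := closedBall (0 : W) 2) (isCompact_closedBall _ _)
    rwa [hr] at this
  have hc : ContDiff ℝ 1 (fun w : W => stereoInvFunAux v (w : Eu (n+1))) :=
    contDiff_stereoInvFunAux.comp W.subtypeL.contDiff
  obtain ⟨K, hK⟩ := hc.contDiffOn.exists_lipschitzOnWith (s := closedBall (0 : W) 2) one_ne_zero
    (convex_closedBall _ _) (isCompact_closedBall _ _)
  have h1 := hK.hausdorffMeasure_image_le (d := (n : ℝ)) (by positivity)
  refine lt_of_le_of_lt (measure_mono ?_) (lt_of_le_of_lt h1 ?_)
  · rintro x ⟨hx, hx0⟩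
    have hx1 : ‖x‖ = 1 := by simpa using hx
    have hxv : x ≠ v := by
      rintro rfl
      simp only [mem_ofPred_eq, real_inner_self_eq_norm_sq] at hx0
      rw [hv] at hx0; norm_num at hx0
    have := stereo_left_inv hv (x := ⟨x, hx⟩) hxv
    refine ⟨stereoToFun v x, ?_, ?_⟩
    · rw [mem_closedBall_zero_iff, stereoToFun_apply, norm_smul]
      have h2 : ‖W.orthogonalProjectionOnto x‖ ≤ 1 :=
        (Submodule.norm_orthogonalProjectionOnto_apply_le _ _).trans hx1.le
      have h3 : ‖(2 : ℝ) / (1 - innerSL ℝ v x)‖ ≤ 2 := by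
        have h0 : inner ℝ v x ≤ 0 := hx0
        rw [innerSL_apply_apply, Real.norm_eq_abs, abs_of_nonneg (div_nonneg (by norm_num) (by linarith))]
        rw [div_le_iff₀ (by linarith)]; linarith
      calc _ ≤ (2 : ℝ) * 1 := mul_le_mul h3 h2 (norm_nonneg _) (by norm_num)
        _ = 2 := by norm_num
    · have := congrArg Subtype.val this
      rwa [stereoInvFun_apply] at this
  · exact ENNReal.mul_lt_top (by simp) hH

lemma sph_lt_top {n : ℕ} : μH[(n : ℝ)] (sphere (0 : Eu (n+1)) 1) < ⊤ := by
  set v : Eu (n+1) := EuclideanSpace.single 0 1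
  have hv : ‖v‖ = 1 := by simp [v]
  have h1 := hemi_lt_top v hv
  have h2 := hemi_lt_top (-v) (by rw [norm_neg, hv])
  refine lt_of_le_of_lt (measure_mono ?_) (measure_union_lt_top h1 h2)
  intro x hx
  by_cases h : inner ℝ v x ≤ 0
  · exact Or.inl ⟨hx, h⟩
  · refine Or.inr ⟨hx, ?_⟩
    simp only [mem_ofPred_eq, inner_neg_left]; linarith

lemma sph_pos {n : ℕ} : 0 < μH[(n : ℝ)] (sphere (0 : Eu (n+1)) 1) := by
  set v : Eu (n+1) := EuclideanSpace.single 0 1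
  have hv : ‖v‖ = 1 := by simp [v]
  set W : Submodule ℝ (Eu (n+1)) := (Submodule.span ℝ {v})ᗮ with hW
  have hr := sph_fin_rank v hv
  have hH : 0 < (μH[(n : ℝ)] : Measure W) (ball 0 1) := by
    have := isOpen_ball.measure_pos (μH[(Module.finrank ℝ W : ℝ)] : Measure W)
      (U := ball (0 : W) 1) ⟨0, by simp⟩
    rwa [hr] at this
  have hL : LipschitzWith 1 (W.orthogonalProjectionOnto) := by
    refine LipschitzWith.of_dist_le_mul fun x y => ?_
    rw [dist_eq_norm, dist_eq_norm, ← map_sub, NNReal.coe_one, one_mul]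
    exact Submodule.norm_orthogonalProjectionOnto_apply_le _ _
  have h1 := hL.hausdorffMeasure_image_le (d := (n : ℝ)) (by positivity) (sphere (0 : Eu (n+1)) 1)
  simp only [ENNReal.coe_one, ENNReal.one_rpow, one_mul] at h1
  refine lt_of_lt_of_le hH (le_trans (measure_mono ?_) h1)
  intro w hw
  have hw1 : ‖w‖ < 1 := by simpa using hw
  have hvw : inner ℝ (w : Eu (n+1)) v = 0 :=
    (Submodule.mem_orthogonal' _ _).1 w.2 v (Submodule.mem_span_singleton_self v)
  have hsq : 0 ≤ 1 - ‖w‖ ^ 2 := by nlinarith [norm_nonneg w]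
  refine ⟨(w : Eu (n+1)) + Real.sqrt (1 - ‖w‖^2) • v, ?_, ?_⟩
  · rw [mem_sphere_zero_iff_norm]
    have : ‖(w : Eu (n+1)) + Real.sqrt (1 - ‖w‖^2) • v‖ ^ 2 = 1 := by
      rw [norm_add_sq_real, inner_smul_right, hvw, norm_smul, hv, Real.norm_eq_abs, mul_one, sq_abs,
        Real.sq_sqrt hsq]
      simp
    have h0 := norm_nonneg ((w : Eu (n+1)) + Real.sqrt (1 - ‖w‖^2) • v)
    nlinarith
  · rw [map_add, map_smul, Submodule.orthogonalProjectionOnto_mem_subspace_eq_self]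
    have : W.orthogonalProjectionOnto v = 0 := by
      apply Submodule.orthogonalProjectionOnto_orthogonal_apply_eq_zero
      exact Submodule.mem_span_singleton_self v
    rw [this]; simp

lemma exists_isom {n : ℕ} (e e' : Eu n) (h : ‖e‖ = ‖e'‖) :
    ∃ L : Eu n ≃ₗᵢ[ℝ] Eu n, L e = e' :=
  ⟨_, Submodule.reflection_sub h⟩

open scoped Pointwise in
/-- Existence of the normalized invariant measure on the unit sphere. -/
lemma exists_sphMeasure (n : ℕ) (hn : 1 ≤ n) : ∃ μ : Measure (Eu n), IsProbabilityMeasure μ ∧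
    (∀ᵐ θ ∂μ, ‖θ‖ = 1) ∧ (∀ L : Eu n ≃ₗᵢ[ℝ] Eu n, MeasurePreserving L μ μ) ∧
    ∀ (g : Eu n → ℝ) (r : ℝ), 0 < r → sphAvg g r = ∫ θ, g (r • θ) ∂μ := by
  obtain ⟨n, rfl⟩ : ∃ m, n = m + 1 := ⟨n - 1, by omega⟩
  have hd : ((n + 1 : ℕ) : ℝ) - 1 = n := by push_cast; ring
  set S := sphere (0 : Eu (n+1)) 1 with hS
  have hSm : MeasurableSet S := isClosed_sphere.measurableSet
  have hfin := sph_lt_top (n := n)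
  have hpos := sph_pos (n := n)
  set c := μH[(n : ℝ)] S with hc
  refine ⟨c⁻¹ • μH[(n : ℝ)].restrict S, ⟨?_⟩, ?_, ?_, ?_⟩
  · simp only [Measure.smul_apply, Measure.restrict_apply_univ, smul_eq_mul]
    exact ENNReal.inv_mul_cancel hpos.ne' hfin.ne
  · apply Measure.ae_smul_measure
    filter_upwards [ae_restrict_mem hSm] with θ hθ
    simpa [S] using hθ
  · intro L
    refine ⟨L.continuous.measurable, ?_⟩
    rw [Measure.map_smul]
    congr 1
    have := (L.toIsometryEquiv.measurePreserving_hausdorffMeasure (n : ℝ)).restrict_preimage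
      (s := S) hSm
    have hp : L.toIsometryEquiv ⁻¹' S = S := by
      ext x; simp [S]
    rw [hp] at this
    exact this.map_eq
  · intro g r hr
    have hSr : sphere (0 : Eu (n+1)) r = r • S := by
      simp [S, smul_sphere' hr.ne', abs_of_pos hr]
    have hmap : μH[(n : ℝ)].restrict (sphere (0 : Eu (n+1)) r) =
        (‖r‖₊ ^ (n : ℝ) : NNReal) • (μH[(n : ℝ)].restrict S).map (fun θ => r • θ) := by
      ext A hA
      rw [Measure.restrict_apply hA, Measure.smul_apply, Measure.map_apply (by fun_prop) hA,
        Measure.restrict_apply (hA.preimage (by fun_prop)),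
        ← Measure.hausdorffMeasure_smul₀ (by positivity) hr.ne']
      congr 1
      rw [smul_set_inter₀ hr.ne', ← hSr]
      congr 1
      ext x
      rw [Set.mem_smul_set_iff_inv_smul_mem₀ hr.ne']
      simp [smul_smul, mul_inv_cancel₀ hr.ne']
    have hemb : MeasurableEmbedding (fun θ : Eu (n+1) => r • θ) :=
      (Homeomorph.smulOfNeZero r hr.ne').measurableEmbedding
    unfold sphAvg
    rw [hd, hmap, hSr, Measure.hausdorffMeasure_smul₀ (by positivity) hr.ne', ← hc,
      integral_smul_nnreal_measure,
      hemb.integral_map,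
      integral_smul_measure]
    have hrp : (0 : ℝ) < ((‖r‖₊ ^ (n : ℝ) : NNReal) : ℝ) := by
      have : 0 < ‖r‖₊ := by simpa using hr.ne'
      exact NNReal.coe_pos.2 (NNReal.rpow_pos this)
    simp only [ENNReal.toReal_smul, NNReal.smul_def, smul_eq_mul, ENNReal.toReal_inv]
    rw [mul_inv]
    have : ∀ a b i : ℝ, a ≠ 0 → a⁻¹ * b * (a * i) = b * i := by
      intro a b i ha; field_simp
    exact this _ _ _ hrp.ne'

lemma exists_unit {n : ℕ} (hn : 1 ≤ n) (ξ : Eu n) : ∃ e : Eu n, ‖e‖ = 1 ∧ ξ = ‖ξ‖ • e := by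
  by_cases h : ξ = 0
  · exact ⟨EuclideanSpace.single ⟨0, hn⟩ 1, by simp, by simp [h]⟩
  · have h0 : ‖ξ‖ ≠ 0 := by simpa using h
    exact ⟨‖ξ‖⁻¹ • ξ, by rw [norm_smul, norm_inv, norm_norm, inv_mul_cancel₀ h0],
      by rw [smul_smul, mul_inv_cancel₀ h0, one_smul]⟩

lemma norm_swap {n : ℕ} (r s : ℝ) (e θ : Eu n) (he : ‖e‖ = 1) (hθ : ‖θ‖ = 1) :
    ‖r • e - s • θ‖ = ‖r • θ - s • e‖ := by
  have h : ‖r • e - s • θ‖ ^ 2 = ‖r • θ - s • e‖ ^ 2 := by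
    rw [norm_sub_sq_real, norm_sub_sq_real, norm_smul, norm_smul, norm_smul, norm_smul, he, hθ,
      real_inner_smul_left, real_inner_smul_right, real_inner_smul_left, real_inner_smul_right,
      real_inner_comm]
  exact (sq_eq_sq₀ (norm_nonneg _) (norm_nonneg _)).1 h

lemma rot_ker {n : ℕ} (hn : 1 ≤ n) {μ : Measure (Eu n)} (h1 : ∀ᵐ θ ∂μ, ‖θ‖ = 1)
    (hL : ∀ L : Eu n ≃ₗᵢ[ℝ] Eu n, MeasurePreserving L μ μ) (k : ℝ → ENNReal) (hk : Measurable k)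
    (x ξ : Eu n) :
    ∫⁻ θ, k ‖x - ‖ξ‖ • θ‖ ∂μ = ∫⁻ θ, k ‖‖x‖ • θ - ξ‖ ∂μ := by
  obtain ⟨e, he, hξ⟩ := exists_unit hn ξ
  obtain ⟨L, hLe⟩ := exists_isom (‖x‖ • e) x (by rw [norm_smul, he, norm_norm, mul_one])
  rw [← (hL L).lintegral_comp (f := fun θ => k ‖x - ‖ξ‖ • θ‖) (by fun_prop)]
  apply lintegral_congr_ae
  filter_upwards [h1] with θ hθ
  have : ‖x - ‖ξ‖ • L θ‖ = ‖‖x‖ • θ - ξ‖ := by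
    conv_lhs => rw [← hLe]
    conv_rhs => rw [hξ]
    rw [← map_smul, ← map_sub, L.norm_map, norm_swap _ _ _ _ he hθ]
  simp only [this]

lemma radial_pot {n : ℕ} (F k : ℝ → ENNReal) (hF : Measurable F) (hk : Measurable k) (ξ ξ' : Eu n)
    (h : ‖ξ‖ = ‖ξ'‖) :
    ∫⁻ x : Eu n, F ‖x‖ * k ‖x - ξ‖ = ∫⁻ x : Eu n, F ‖x‖ * k ‖x - ξ'‖ := by
  obtain ⟨L, hLe⟩ := exists_isom ξ ξ' h
  rw [← L.measurePreserving.lintegral_comp (f := fun x => F ‖x‖ * k ‖x - ξ'‖) (by fun_prop)]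
  apply lintegral_congr
  intro x
  rw [← hLe, ← map_sub, L.norm_map, L.norm_map]

lemma avg_ker {n : ℕ} (hn : 1 ≤ n) {μ : Measure (Eu n)} [IsProbabilityMeasure μ]
    (h1 : ∀ᵐ θ ∂μ, ‖θ‖ = 1)
    (hL : ∀ L : Eu n ≃ₗᵢ[ℝ] Eu n, MeasurePreserving L μ μ) (F k : ℝ → ENNReal)
    (hF : Measurable F) (hk : Measurable k) (ξ : Eu n) :
    ∫⁻ x : Eu n, F ‖x‖ * k ‖x - ξ‖ = ∫⁻ x : Eu n, F ‖x‖ * ∫⁻ θ, k ‖‖x‖ • θ - ξ‖ ∂μ := by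
  calc ∫⁻ x : Eu n, F ‖x‖ * k ‖x - ξ‖
      = ∫⁻ θ, (∫⁻ x : Eu n, F ‖x‖ * k ‖x - ξ‖) ∂μ := by simp
    _ = ∫⁻ θ, (∫⁻ x : Eu n, F ‖x‖ * k ‖x - ‖ξ‖ • θ‖) ∂μ := by
        apply lintegral_congr_ae
        filter_upwards [h1] with θ hθ
        exact radial_pot F k hF hk _ _ (by rw [norm_smul, hθ, norm_norm, mul_one])
    _ = ∫⁻ x : Eu n, (∫⁻ θ, F ‖x‖ * k ‖x - ‖ξ‖ • θ‖ ∂μ) :=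
        lintegral_lintegral_swap (by fun_prop)
    _ = _ := by
        apply lintegral_congr
        intro x
        rw [lintegral_const_mul _ (by fun_prop), rot_ker hn h1 hL k hk]

lemma ker_meas {n : ℕ} (γ : ℝ) : Measurable (fun p : Eu n × Eu n => ‖p.1 - p.2‖ ^ γ) := by
  fun_prop

lemma ker_int {n : ℕ} (hn : 1 ≤ n) (γ : ℝ) (h0 : -(n : ℝ) < γ) :
    IntegrableOn (fun z : Eu n => ‖z‖ ^ γ) (ball 0 1) := by
  refine integrableOn_ball_of_norm_le_rpow (C := 1) (α := -γ) (r := 1) (by simpa using hn)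
    (by simp; linarith) ?_ (by fun_prop : Measurable (fun z : Eu n => ‖z‖ ^ γ)).aestronglyMeasurable
  refine Filter.Eventually.of_forall fun z => ?_
  simp only [neg_neg, one_mul]
  rw [Real.norm_eq_abs, abs_of_nonneg (by positivity)]

lemma pot_bdd {n : ℕ} (hn : 1 ≤ n) (γ : ℝ) (h0 : -(n : ℝ) < γ) (h1 : γ ≤ 0) (f : Eu n → ℝ)
    (hf : Integrable f) (hf1 : ∀ x, |f x| ≤ 1) :
    ∃ C : ENNReal, C ≠ ⊤ ∧ ∀ y, ∫⁻ ξ, ‖f ξ * ‖y - ξ‖ ^ γ‖ₑ ≤ C := by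
  refine ⟨(∫⁻ z in ball (0 : Eu n) 1, ‖‖z‖ ^ γ‖ₑ) + ∫⁻ ξ, ‖f ξ‖ₑ, ?_, ?_⟩
  · exact ENNReal.add_ne_top.2 ⟨(ker_int hn γ h0).2.ne, hf.2.ne⟩
  · intro y
    calc ∫⁻ ξ, ‖f ξ * ‖y - ξ‖ ^ γ‖ₑ
        ≤ ∫⁻ ξ, ((ball (0 : Eu n) 1).indicator (fun z => ‖‖z‖ ^ γ‖ₑ) (y - ξ) + ‖f ξ‖ₑ) := by
          apply lintegral_mono
          intro ξ
          beta_reduce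
          rw [enorm_mul]
          by_cases h : y - ξ ∈ ball (0 : Eu n) 1
          · rw [indicator_of_mem h]
            refine le_add_right ?_
            have : ‖f ξ‖ₑ ≤ 1 := by
              rw [← ofReal_norm, Real.norm_eq_abs]; exact ENNReal.ofReal_le_one.2 (hf1 ξ)
            calc _ ≤ 1 * ‖‖y - ξ‖ ^ γ‖ₑ := by gcongr
              _ = _ := one_mul _
          · rw [indicator_of_notMem h, zero_add]
            have : ‖‖y - ξ‖ ^ γ‖ₑ ≤ 1 := by
              rw [← ofReal_norm, Real.norm_eq_abs, abs_of_nonneg (by positivity)]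
              refine ENNReal.ofReal_le_one.2 (Real.rpow_le_one_of_one_le_of_nonpos ?_ h1)
              simpa using h
            calc _ ≤ ‖f ξ‖ₑ * 1 := by gcongr
              _ = _ := mul_one _
      _ = (∫⁻ ξ, (ball (0 : Eu n) 1).indicator (fun z => ‖‖z‖ ^ γ‖ₑ) (y - ξ)) + ∫⁻ ξ, ‖f ξ‖ₑ := by
          rw [lintegral_add_left']
          exact Measurable.aemeasurable ((Measurable.indicator (by fun_prop) measurableSet_ball).comp (by fun_prop))
      _ = _ := by
          rw [lintegral_sub_left_eq_self
            (fun z => (ball (0 : Eu n) 1).indicator (fun z => ‖‖z‖ ^ γ‖ₑ) z) y,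
            lintegral_indicator measurableSet_ball]

lemma pot_fubini {n : ℕ} (hn : 1 ≤ n) (γ : ℝ) (h0 : -(n : ℝ) < γ) (h1 : γ ≤ 0) (f : Eu n → ℝ)
    (hf : Integrable f) (hf1 : ∀ x, |f x| ≤ 1) (ρ : Measure (Eu n)) [IsFiniteMeasure ρ] :
    ∫ y, (∫ ξ, f ξ * ‖y - ξ‖ ^ γ) ∂ρ =
      ∫ ξ, f ξ * (∫⁻ y, ENNReal.ofReal (‖y - ξ‖ ^ γ) ∂ρ).toReal := by
  obtain ⟨C, hC, hCb⟩ := pot_bdd hn γ h0 h1 f hf hf1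
  have hm : AEStronglyMeasurable (fun p : Eu n × Eu n => f p.2 * ‖p.1 - p.2‖ ^ γ) (ρ.prod volume) :=
    (hf.1.comp_snd).mul (ker_meas γ).aestronglyMeasurable
  have hint : Integrable (fun p : Eu n × Eu n => f p.2 * ‖p.1 - p.2‖ ^ γ) (ρ.prod volume) := by
    refine ⟨hm, ?_⟩
    rw [hasFiniteIntegral_iff_enorm, lintegral_prod _ hm.enorm]
    calc _ ≤ ∫⁻ y, C ∂ρ := lintegral_mono fun y => hCb y
      _ < ⊤ := by rw [lintegral_const]; exact ENNReal.mul_lt_top hC.lt_top (measure_lt_top _ _)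
  rw [integral_integral_swap hint]
  congr 1
  ext ξ
  rw [integral_const_mul]
  congr 1
  rw [integral_eq_lintegral_of_nonneg_ae]
  · exact Filter.Eventually.of_forall fun y => by positivity
  · exact (by fun_prop : Measurable (fun y : Eu n => ‖y - ξ‖ ^ γ)).aestronglyMeasurable

/-- Replacing a potential by its spherical averages against a radial density. -/
lemma pot_avg {n : ℕ} (hn : 1 ≤ n) {μ : Measure (Eu n)} [IsProbabilityMeasure μ]
    (hμ : ∀ᵐ θ ∂μ, ‖θ‖ = 1)
    (hL : ∀ L : Eu n ≃ₗᵢ[ℝ] Eu n, MeasurePreserving L μ μ)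
    (γ : ℝ) (h0 : -(n : ℝ) < γ) (h1 : γ ≤ 0) (f : Eu n → ℝ)
    (hf : Integrable f) (hf1 : ∀ x, |f x| ≤ 1) (F : ℝ → ℝ) (hF : Measurable F)
    (hF0 : ∀ r, 0 ≤ F r) (hFi : Integrable (fun x : Eu n => F ‖x‖)) :
    (∫ x, F ‖x‖ * (∫ ξ, f ξ * ‖x - ξ‖ ^ γ)) = 
      (∫ x : Eu n, F ‖x‖ * ∫ θ, (∫ ξ, f ξ * ‖‖x‖ • θ - ξ‖ ^ γ) ∂μ) ∧
    (∫ x, F ‖x‖ * (∫ ξ, f ξ * ‖x - ξ‖ ^ γ)) = ∫ ξ, f ξ * ∫ x, F ‖x‖ * ‖x - ξ‖ ^ γ ∧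
    Integrable (fun x : Eu n => F ‖x‖ * ∫ θ, (∫ ξ, f ξ * ‖‖x‖ • θ - ξ‖ ^ γ) ∂μ) := by
  obtain ⟨C, hC, hCb⟩ := pot_bdd hn γ h0 h1 f hf hf1
  set u : Eu n → ℝ := fun y => ∫ ξ, f ξ * ‖y - ξ‖ ^ γ with hu
  have hub : ∀ y, ‖u y‖ ≤ C.toReal := by
    intro y
    have := (enorm_integral_le_lintegral_enorm (fun ξ => f ξ * ‖y - ξ‖ ^ γ)).trans (hCb y)
    rw [← ofReal_norm] at this
    exact (ENNReal.ofReal_le_iff_le_toReal hC).1 this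
  have huM : Measurable u := by
    have h2 : u = fun y => ∫ ξ, hf.1.mk f ξ * ‖y - ξ‖ ^ γ := by
      ext y
      apply integral_congr_ae
      filter_upwards [hf.1.ae_eq_mk] with ξ hξ
      rw [hξ]
    rw [h2]
    have : StronglyMeasurable (fun p : Eu n × Eu n => hf.1.mk f p.2 * ‖p.1 - p.2‖ ^ γ) :=
      (hf.1.stronglyMeasurable_mk.comp_measurable measurable_snd).mul (ker_meas γ).stronglyMeasurable
    exact (this.integral_prod_right').measurable
  set ρ : Measure (Eu n) := volume.withDensity (fun x => ENNReal.ofReal (F ‖x‖)) with hρ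
  have hFm : Measurable (fun x : Eu n => ENNReal.ofReal (F ‖x‖)) := by fun_prop
  have : IsFiniteMeasure ρ := isFiniteMeasure_withDensity_ofReal hFi.2
  have hint : ∀ g : Eu n → ℝ, ∫ x, F ‖x‖ * g x = ∫ x, g x ∂ρ := by
    intro g
    rw [hρ, integral_withDensity_eq_integral_toReal_smul hFm (by simp)]
    congr 1; ext x
    rw [ENNReal.toReal_ofReal (hF0 _), smul_eq_mul]
  set ρ' : Measure (Eu n) := (ρ.prod μ).map (fun p => ‖p.1‖ • p.2) with hρ'
  have hpm : Measurable (fun p : Eu n × Eu n => ‖p.1‖ • p.2) := by fun_prop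
  have : IsFiniteMeasure ρ' := by rw [hρ']; infer_instance
  have hker : ∀ ξ, ∫⁻ y, ENNReal.ofReal (‖y - ξ‖ ^ γ) ∂ρ = ∫⁻ y, ENNReal.ofReal (‖y - ξ‖ ^ γ) ∂ρ' := by
    intro ξ
    have hk : Measurable (fun r : ℝ => ENNReal.ofReal (r ^ γ)) := by fun_prop
    rw [hρ', lintegral_map (by fun_prop) hpm, lintegral_prod _ (by fun_prop), hρ,
      lintegral_withDensity_eq_lintegral_mul _ hFm (by fun_prop),
      lintegral_withDensity_eq_lintegral_mul _ hFm (by fun_prop)]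
    exact avg_ker hn hμ hL (fun r => ENNReal.ofReal (F r)) (fun r => ENNReal.ofReal (r ^ γ))
      (by fun_prop) hk ξ
  have huint : Integrable (fun p : Eu n × Eu n => u (‖p.1‖ • p.2)) (ρ.prod μ) :=
    Integrable.of_bound (huM.comp hpm).aestronglyMeasurable C.toReal
      (Filter.Eventually.of_forall fun p => hub _)
  refine ⟨?_, ?_, ?_⟩
  · rw [hint, hint, pot_fubini hn γ h0 h1 f hf hf1 ρ]
    simp_rw [hker]
    rw [← pot_fubini hn γ h0 h1 f hf hf1 ρ', hρ',
      integral_map hpm.aemeasurable huM.aestronglyMeasurable, integral_prod _ huint]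
  · rw [hint, pot_fubini hn γ h0 h1 f hf hf1 ρ]
    congr 1; ext ξ
    rw [hint, integral_eq_lintegral_of_nonneg_ae]
    · exact Filter.Eventually.of_forall fun y => by positivity
    · exact (by fun_prop : Measurable (fun y : Eu n => ‖y - ξ‖ ^ γ)).aestronglyMeasurable
  · refine hFi.mul_bdd (c := C.toReal) ?_ (Filter.Eventually.of_forall fun x => ?_)
    · have : StronglyMeasurable (fun p : Eu n × Eu n => u (‖p.1‖ • p.2)) :=
        (huM.comp hpm).stronglyMeasurable
      exact this.integral_prod_right'.aestronglyMeasurable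
    · refine (norm_integral_le_of_norm_le_const (Filter.Eventually.of_forall fun θ => hub _)).trans ?_
      simp

lemma ker_ball_int {n : ℕ} (hn : 1 ≤ n) (γ : ℝ) (h0 : -(n : ℝ) < γ) (h1 : γ ≤ 0) (R : ℝ)
    (ξ : Eu n) : IntegrableOn (fun x : Eu n => ‖x - ξ‖ ^ γ) (ball 0 R) := by
  obtain ⟨C, hC, hCb⟩ := pot_bdd hn γ h0 h1 ((ball (0 : Eu n) R).indicator 1)
    ((integrable_indicator_iff measurableSet_ball).2 (integrableOn_const measure_ball_lt_top.ne))
    (fun x => by by_cases h : x ∈ ball (0 : Eu n) R <;> simp [indicator, h])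
  rw [← integrable_indicator_iff measurableSet_ball]
  refine ⟨((by fun_prop : Measurable (fun x : Eu n => ‖x - ξ‖ ^ γ)).indicator
    measurableSet_ball).aestronglyMeasurable, ?_⟩
  rw [hasFiniteIntegral_iff_enorm]
  refine lt_of_le_of_lt (le_trans (le_of_eq ?_) (hCb ξ)) hC.lt_top
  congr 1; ext x
  by_cases h : x ∈ ball (0 : Eu n) R
  · simp [indicator, h, norm_sub_rev ξ x]
  · simp [indicator, h]

lemma ker_ball_one {n : ℕ} (hn : 1 ≤ n) (γ : ℝ) (h0 : -(n : ℝ) < γ) (h1 : γ ≤ 0) :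
    ∃ C : ℝ, 0 ≤ C ∧ ∀ ξ : Eu n, ∫ x in ball (0 : Eu n) 1, ‖x - ξ‖ ^ γ ≤ C := by
  obtain ⟨C, hC, hCb⟩ := pot_bdd hn γ h0 h1 ((ball (0 : Eu n) 1).indicator 1)
    ((integrable_indicator_iff measurableSet_ball).2 (integrableOn_const measure_ball_lt_top.ne))
    (fun x => by by_cases h : x ∈ ball (0 : Eu n) 1 <;> simp [indicator, h])
  refine ⟨C.toReal, ENNReal.toReal_nonneg, fun ξ => ?_⟩
  rw [← integral_indicator measurableSet_ball]
  have h2 : (ball (0 : Eu n) 1).indicator (fun x => ‖x - ξ‖ ^ γ) =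
      fun x => (ball (0 : Eu n) 1).indicator (1 : Eu n → ℝ) x * ‖ξ - x‖ ^ γ := by
    ext x
    by_cases h : x ∈ ball (0 : Eu n) 1
    · simp [indicator, h, norm_sub_rev ξ x]
    · simp [indicator, h]
  rw [h2]
  have := (enorm_integral_le_lintegral_enorm
    (fun x => (ball (0 : Eu n) 1).indicator (1 : Eu n → ℝ) x * ‖ξ - x‖ ^ γ)).trans (hCb ξ)
  rw [← ofReal_norm] at this
  exact (le_abs_self _).trans ((ENNReal.ofReal_le_iff_le_toReal hC).1 this)

lemma ker_ball_scale {n : ℕ} (hn : 1 ≤ n) (γ : ℝ) (h0 : -(n : ℝ) < γ) (h1 : γ ≤ 0) :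
    ∃ C : ℝ, 0 ≤ C ∧ ∀ (ξ : Eu n) (R : ℝ), 0 < R →
      ∫ x in ball (0 : Eu n) R, ‖x - ξ‖ ^ γ ≤ C * R ^ n * R ^ γ := by
  obtain ⟨C, hC, hCb⟩ := ker_ball_one hn γ h0 h1
  refine ⟨C, hC, fun ξ R hR => ?_⟩
  have h2 := Measure.integral_comp_smul (volume : Measure (Eu n))
    ((ball (0 : Eu n) R).indicator (fun x => ‖x - ξ‖ ^ γ)) R
  have h3 : (fun x : Eu n => (ball (0 : Eu n) R).indicator (fun x => ‖x - ξ‖ ^ γ) (R • x)) =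
      (ball (0 : Eu n) 1).indicator (fun x => R ^ γ * ‖x - R⁻¹ • ξ‖ ^ γ) := by
    ext x
    have h4 : R • x ∈ ball (0 : Eu n) R ↔ x ∈ ball (0 : Eu n) 1 := by
      rw [mem_ball_zero_iff, mem_ball_zero_iff, norm_smul, Real.norm_eq_abs, abs_of_pos hR]
      constructor
      · intro h; by_contra hh; push Not at hh; nlinarith
      · intro h; nlinarith
    by_cases h : x ∈ ball (0 : Eu n) 1
    · rw [indicator_of_mem h, indicator_of_mem (h4.2 h), ← Real.mul_rpow hR.le (norm_nonneg _)]
      congr 1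
      rw [← abs_of_pos hR, ← Real.norm_eq_abs, ← norm_smul, smul_sub, Real.norm_eq_abs, abs_of_pos hR,
        smul_smul, mul_inv_cancel₀ hR.ne', one_smul]
    · rw [indicator_of_notMem h, indicator_of_notMem (fun h' => h (h4.1 h'))]
  rw [h3, integral_indicator measurableSet_ball, integral_indicator measurableSet_ball,
    integral_const_mul] at h2
  simp only [finrank_euclideanSpace, Fintype.card_fin, smul_eq_mul] at h2
  have hRn : 0 < R ^ n := by positivity
  rw [abs_of_pos (by positivity)] at h2
  have h5 : ∫ x in ball (0 : Eu n) R, ‖x - ξ‖ ^ γ =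
      R ^ n * (R ^ γ * ∫ x in ball (0 : Eu n) 1, ‖x - R⁻¹ • ξ‖ ^ γ) := by
    rw [h2]; field_simp
  rw [h5]
  have := hCb (R⁻¹ • ξ)
  have hRg : 0 < R ^ γ := by positivity
  calc R ^ n * (R ^ γ * ∫ x in ball (0 : Eu n) 1, ‖x - R⁻¹ • ξ‖ ^ γ) ≤ R ^ n * (R ^ γ * C) := by
        gcongr
    _ = _ := by ring

lemma wker_int {n : ℕ} (hn : 1 ≤ n) (γ : ℝ) (h0 : -(n : ℝ) < γ) (h1 : γ ≤ 0) (R : ℝ)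
    (ξ : Eu n) (g : Eu n → ℝ) (hg : Continuous g) (hgR : ∀ x, x ∉ ball (0 : Eu n) R → g x = 0) :
    Integrable (fun x => g x * ‖x - ξ‖ ^ γ) := by
  have hcs : HasCompactSupport g :=
    HasCompactSupport.intro (isCompact_closedBall (0 : Eu n) R)
      fun x hx => hgR x fun h => hx (ball_subset_closedBall h)
  obtain ⟨C, hC⟩ := hg.bounded_above_of_compact_support hcs
  have h2 := (integrable_indicator_iff measurableSet_ball).2 (ker_ball_int hn γ h0 h1 R ξ)
  have h3 := h2.bdd_mul (c := C) hg.aestronglyMeasurable (Filter.Eventually.of_forall hC)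
  refine h3.congr (Filter.Eventually.of_forall fun x => ?_)
  by_cases h : x ∈ ball (0 : Eu n) R
  · simp [indicator, h]
  · simp [indicator, h, hgR x h]

lemma ld1 {n : ℕ} (q : ℝ → ℝ) (d : ℝ) (ξ x : Eu n) (i : Fin n) (h : HasDerivAt q d (‖x - ξ‖ ^ 2)) :
    HasLineDerivAt ℝ (fun y => q (‖y - ξ‖ ^ 2)) (2 * (x i - ξ i) * d) x (EuclideanSpace.single i 1) := by
  unfold HasLineDerivAt
  have h2 : ∀ t : ℝ, ‖x + t • EuclideanSpace.single i (1 : ℝ) - ξ‖ ^ 2 =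
      ‖x - ξ‖ ^ 2 + 2 * (x i - ξ i) * t + t ^ 2 := by
    intro t
    have : x + t • EuclideanSpace.single i (1 : ℝ) - ξ = (x - ξ) + t • EuclideanSpace.single i (1 : ℝ) := by
      abel
    rw [this, norm_add_sq_real, inner_smul_right, norm_smul, EuclideanSpace.inner_single_right]
    simp
    ring
  have h3 : HasDerivAt (fun t : ℝ => ‖x - ξ‖ ^ 2 + 2 * (x i - ξ i) * t + t ^ 2) (2 * (x i - ξ i)) 0 := by
    have := (((hasDerivAt_id (0:ℝ)).const_mul (2 * (x i - ξ i))).const_add (‖x - ξ‖ ^ 2)).add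
      (hasDerivAt_pow 2 (0:ℝ))
    convert! this using 1
    simp
  simp only [h2]
  have h4 : HasDerivAt q d (‖x - ξ‖ ^ 2 + 2 * (x i - ξ i) * 0 + 0 ^ 2) := by simpa using h
  have := HasDerivAt.comp (0:ℝ) h4 h3
  convert! this using 1
  ring

lemma ld2 {n : ℕ} (q : ℝ → ℝ) (d : ℝ) (ξ x : Eu n) (i : Fin n) (h : HasDerivAt q d (‖x - ξ‖ ^ 2)) :
    HasLineDerivAt ℝ (fun y => 2 * (y i - ξ i) * q (‖y - ξ‖ ^ 2))
      (2 * q (‖x - ξ‖ ^ 2) + 4 * (x i - ξ i) ^ 2 * d) x (EuclideanSpace.single i 1) := by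
  have h1 := ld1 q d ξ x i h
  unfold HasLineDerivAt at h1 ⊢
  have h2 : HasDerivAt (fun t : ℝ => 2 * ((x + t • EuclideanSpace.single i (1 : ℝ)) i - ξ i)) 2 0 := by
    have : (fun t : ℝ => 2 * ((x + t • EuclideanSpace.single i (1 : ℝ)) i - ξ i)) =
        fun t : ℝ => 2 * t + 2 * (x i - ξ i) := by
      ext t; simp; ring
    rw [this]
    simpa using ((hasDerivAt_id (0:ℝ)).const_mul 2).add_const (2 * (x i - ξ i))
  convert! h2.mul h1 using 1
  simp
  ring

lemma ibp {n : ℕ} {f f' g g' : Eu n → ℝ} {v : Eu n} (hf'g : Integrable (fun x => f' x * g x))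
    (hfg' : Integrable (fun x => f x * g' x)) (hfg : Integrable (fun x => f x * g x))
    (hf : ∀ x, HasLineDerivAt ℝ f (f' x) x v) (hg : ∀ x, HasLineDerivAt ℝ g (g' x) x v) :
    ∫ x, f x * g' x = - ∫ x, f' x * g x :=
  integral_bilinear_hasLineDerivAt_right_eq_neg_left_of_integrable
    (B := ContinuousLinearMap.mul ℝ ℝ) hf'g hfg' hfg (fun x _ => hf x) (fun x _ => hg x)

lemma int_cs {n : ℕ} (M : ℝ) (f g : Eu n → ℝ) (hf : Continuous f) (hg : Continuous g)
    (h : ∀ x, M < ‖x‖ → f x = 0) : Integrable (fun x => f x * g x) := by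
  refine (hf.mul hg).integrable_of_hasCompactSupport
    (HasCompactSupport.intro (isCompact_closedBall (0 : Eu n) M) fun x hx => ?_)
  show f x * g x = 0
  rw [h x (by simpa using hx), zero_mul]

lemma cont_comp {n : ℕ} (q : ℝ → ℝ) (hq : ContinuousOn q (Ici 0)) (ξ : Eu n) :
    Continuous (fun x : Eu n => q (‖x - ξ‖ ^ 2)) :=
  hq.comp_continuous (by fun_prop) (fun x => by simp only [mem_Ici]; positivity)

lemma green {n : ℕ} (k k1 k2 q q1 q2 : ℝ → ℝ) (M : ℝ)
    (hk : ∀ s, 0 ≤ s → HasDerivAt k (k1 s) s) (hk1 : ∀ s, 0 ≤ s → HasDerivAt k1 (k2 s) s)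
    (hk2 : ContinuousOn k2 (Ici 0))
    (hq : ∀ s, 0 ≤ s → HasDerivAt q (q1 s) s) (hq1 : ∀ s, 0 ≤ s → HasDerivAt q1 (q2 s) s)
    (hq2 : ContinuousOn q2 (Ici 0))
    (h0 : ∀ x : Eu n, M < ‖x‖ → k (‖x‖ ^ 2) = 0) (h1 : ∀ x : Eu n, M < ‖x‖ → k1 (‖x‖ ^ 2) = 0)
    (h2 : ∀ x : Eu n, M < ‖x‖ → k2 (‖x‖ ^ 2) = 0) (ξ : Eu n) :
    ∫ x, k (‖x‖ ^ 2) * (4 * ‖x - ξ‖ ^ 2 * q2 (‖x - ξ‖ ^ 2) + 2 * n * q1 (‖x - ξ‖ ^ 2)) =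
    ∫ x, (4 * ‖x‖ ^ 2 * k2 (‖x‖ ^ 2) + 2 * n * k1 (‖x‖ ^ 2)) * q (‖x - ξ‖ ^ 2) := by
  have ck : Continuous (fun x : Eu n => k (‖x‖ ^ 2)) := by
    simpa using cont_comp k (fun s hs => (hk s hs).continuousAt.continuousWithinAt) (0 : Eu n)
  have ck1 : Continuous (fun x : Eu n => k1 (‖x‖ ^ 2)) := by
    simpa using cont_comp k1 (fun s hs => (hk1 s hs).continuousAt.continuousWithinAt) (0 : Eu n)
  have ck2 : Continuous (fun x : Eu n => k2 (‖x‖ ^ 2)) := by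
    simpa using cont_comp k2 hk2 (0 : Eu n)
  have cq : Continuous (fun x : Eu n => q (‖x - ξ‖ ^ 2)) :=
    cont_comp q (fun s hs => (hq s hs).continuousAt.continuousWithinAt) ξ
  have cq1 : Continuous (fun x : Eu n => q1 (‖x - ξ‖ ^ 2)) :=
    cont_comp q1 (fun s hs => (hq1 s hs).continuousAt.continuousWithinAt) ξ
  have cq2 : Continuous (fun x : Eu n => q2 (‖x - ξ‖ ^ 2)) := cont_comp q2 hq2 ξ
  have cx : ∀ i : Fin n, Continuous (fun x : Eu n => x i) := fun i => by fun_prop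
  have A1 : ∀ i : Fin n, Integrable (fun x : Eu n =>
      k (‖x‖ ^ 2) * (2 * q1 (‖x - ξ‖ ^ 2) + 4 * (x i - ξ i) ^ 2 * q2 (‖x - ξ‖ ^ 2))) := fun i =>
    int_cs M _ _ ck ((continuous_const.mul cq1).add
      ((continuous_const.mul (((cx i).sub continuous_const).pow 2)).mul cq2)) h0
  have A2 : ∀ i : Fin n, Integrable (fun x : Eu n =>
      (2 * k1 (‖x‖ ^ 2) + 4 * (x i) ^ 2 * k2 (‖x‖ ^ 2)) * q (‖x - ξ‖ ^ 2)) := fun i =>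
    int_cs M _ _ ((continuous_const.mul ck1).add
      ((continuous_const.mul ((cx i).pow 2)).mul ck2)) cq (fun x hx => by rw [h1 x hx, h2 x hx]; ring)
  have key : ∀ i : Fin n, ∫ x, k (‖x‖ ^ 2) *
      (2 * q1 (‖x - ξ‖ ^ 2) + 4 * (x i - ξ i) ^ 2 * q2 (‖x - ξ‖ ^ 2)) =
      ∫ x, (2 * k1 (‖x‖ ^ 2) + 4 * (x i) ^ 2 * k2 (‖x‖ ^ 2)) * q (‖x - ξ‖ ^ 2) := by
    intro i
    have dk : ∀ x : Eu n, HasLineDerivAt ℝ (fun y : Eu n => k (‖y‖ ^ 2))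
        (2 * x i * k1 (‖x‖ ^ 2)) x (EuclideanSpace.single i 1) := fun x => by
      simpa using ld1 k _ 0 x i (by simpa using hk (‖x‖ ^ 2) (by positivity))
    have dk1 : ∀ x : Eu n, HasLineDerivAt ℝ (fun y : Eu n => 2 * y i * k1 (‖y‖ ^ 2))
        (2 * k1 (‖x‖ ^ 2) + 4 * (x i) ^ 2 * k2 (‖x‖ ^ 2)) x (EuclideanSpace.single i 1) := fun x => by
      simpa using ld2 k1 _ 0 x i (by simpa using hk1 (‖x‖ ^ 2) (by positivity))
    have dq := fun x : Eu n => ld1 q _ ξ x i (hq (‖x - ξ‖ ^ 2) (by positivity))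
    have dq1 := fun x : Eu n => ld2 q1 _ ξ x i (hq1 (‖x - ξ‖ ^ 2) (by positivity))
    have I1 : Integrable (fun x : Eu n => (2 * x i * k1 (‖x‖ ^ 2)) * (2 * (x i - ξ i) * q1 (‖x - ξ‖ ^ 2))) :=
      int_cs M _ _ ((continuous_const.mul (cx i)).mul ck1)
        ((continuous_const.mul ((cx i).sub continuous_const)).mul cq1) (fun x hx => by rw [h1 x hx]; ring)
    rw [ibp I1 (A1 i) (int_cs M _ _ ck
      ((continuous_const.mul ((cx i).sub continuous_const)).mul cq1) h0) dk dq1,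
      ibp (A2 i) I1 (int_cs M _ _ ((continuous_const.mul (cx i)).mul ck1) cq (fun x hx => by rw [h1 x hx]; ring)) dk1 dq, neg_neg]
  have sum_sq : ∀ y : Eu n, ∑ i, (y i) ^ 2 = ‖y‖ ^ 2 := fun y => by
    rw [EuclideanSpace.norm_sq_eq]; simp
  have S1 := integral_finsetSum Finset.univ (fun i _ => A1 i)
  have S2 := integral_finsetSum Finset.univ (fun i _ => A2 i)
  have S3 : (fun x : Eu n => k (‖x‖ ^ 2) * (4 * ‖x - ξ‖ ^ 2 * q2 (‖x - ξ‖ ^ 2) + 2 * n * q1 (‖x - ξ‖ ^ 2))) =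
      fun x => ∑ i, k (‖x‖ ^ 2) * (2 * q1 (‖x - ξ‖ ^ 2) + 4 * (x i - ξ i) ^ 2 * q2 (‖x - ξ‖ ^ 2)) := by
    ext x
    rw [← Finset.mul_sum, Finset.sum_add_distrib, Finset.sum_const, Finset.card_univ, Fintype.card_fin,
      nsmul_eq_mul, ← Finset.sum_mul, ← Finset.mul_sum, ← sum_sq (x - ξ)]
    simp only [PiLp.sub_apply]; ring
  have S4 : (fun x : Eu n => (4 * ‖x‖ ^ 2 * k2 (‖x‖ ^ 2) + 2 * n * k1 (‖x‖ ^ 2)) * q (‖x - ξ‖ ^ 2)) =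
      fun x => ∑ i, (2 * k1 (‖x‖ ^ 2) + 4 * (x i) ^ 2 * k2 (‖x‖ ^ 2)) * q (‖x - ξ‖ ^ 2) := by
    ext x
    rw [← Finset.sum_mul, Finset.sum_add_distrib, Finset.sum_const, Finset.card_univ, Fintype.card_fin,
      nsmul_eq_mul, ← Finset.sum_mul, ← Finset.mul_sum, sum_sq x]
    ring
  rw [S3, S4, S1, S2]
  exact Finset.sum_congr rfl fun i _ => key i

lemma reg_deriv (p ε : ℝ) (hε : 0 < ε) (s : ℝ) (hs : 0 ≤ s) :
    HasDerivAt (fun s : ℝ => (s + ε) ^ p) (p * (s + ε) ^ (p - 1)) s := by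
  have h := ((hasDerivAt_id s).add_const ε).rpow_const (p := p) (Or.inl (by simp; positivity))
  convert! h using 1
  simp

lemma reg_tendsto (p s : ℝ) (hs : 0 < s) :
    Filter.Tendsto (fun ε : ℝ => (s + ε) ^ p) (nhdsWithin 0 (Ioi 0)) (nhds (s ^ p)) := by
  have h : ContinuousAt (fun ε : ℝ => (s + ε) ^ p) 0 :=
    ContinuousAt.rpow_const (by fun_prop) (Or.inl (by simp; positivity))
  have := h.tendsto
  simp only [add_zero] at this
  exact this.mono_left nhdsWithin_le_nhds

lemma reg_bound (p s ε : ℝ) (hp : p ≤ 0) (hs : 0 < s) (hε : 0 < ε) : (s + ε) ^ p ≤ s ^ p :=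
  Real.rpow_le_rpow_of_nonpos hs (by linarith) hp

lemma norm_pow_rpow {n : ℕ} (x : Eu n) (p : ℝ) : (‖x‖ ^ 2) ^ p = ‖x‖ ^ (2 * p) := by
  rw [← Real.rpow_natCast_mul (norm_nonneg _)]; norm_num

lemma riesz_id {n : ℕ} (hn : 1 ≤ n) (p : ℝ) (hp0 : -(n : ℝ) < 2 * (p - 1)) (hp : p ≤ 0)
    (k k1 k2 : ℝ → ℝ) (M : ℝ)
    (hk : ∀ s, 0 ≤ s → HasDerivAt k (k1 s) s) (hk1 : ∀ s, 0 ≤ s → HasDerivAt k1 (k2 s) s)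
    (hk2 : ContinuousOn k2 (Ici 0))
    (h0 : ∀ x : Eu n, M < ‖x‖ → k (‖x‖ ^ 2) = 0) (h1 : ∀ x : Eu n, M < ‖x‖ → k1 (‖x‖ ^ 2) = 0)
    (h2 : ∀ x : Eu n, M < ‖x‖ → k2 (‖x‖ ^ 2) = 0) (ξ : Eu n) :
    (4 * p * (p - 1) + 2 * n * p) * ∫ x, k (‖x‖ ^ 2) * ‖x - ξ‖ ^ (2 * (p - 1)) =
    ∫ x, (4 * ‖x‖ ^ 2 * k2 (‖x‖ ^ 2) + 2 * n * k1 (‖x‖ ^ 2)) * ‖x - ξ‖ ^ (2 * p) := by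
  have ck : Continuous (fun x : Eu n => k (‖x‖ ^ 2)) := by
    simpa using cont_comp k (fun s hs => (hk s hs).continuousAt.continuousWithinAt) (0 : Eu n)
  have ck1 : Continuous (fun x : Eu n => k1 (‖x‖ ^ 2)) := by
    simpa using cont_comp k1 (fun s hs => (hk1 s hs).continuousAt.continuousWithinAt) (0 : Eu n)
  have ck2 : Continuous (fun x : Eu n => k2 (‖x‖ ^ 2)) := by
    simpa using cont_comp k2 hk2 (0 : Eu n)
  have cN : Continuous (fun x : Eu n => ‖x‖ ^ 2) := by fun_prop
  set g : Eu n → ℝ := fun x => 4 * ‖x‖ ^ 2 * k2 (‖x‖ ^ 2) + 2 * n * k1 (‖x‖ ^ 2) with hg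
  have cg : Continuous g := ((continuous_const.mul cN).mul ck2).add (continuous_const.mul ck1)
  have hgM : ∀ x, x ∉ ball (0 : Eu n) (M + 1) → g x = 0 := fun x hx => by
    have : M < ‖x‖ := by
      have : M + 1 ≤ ‖x‖ := by simpa using hx
      linarith
    simp only [hg, h1 x this, h2 x this]; ring
  have hkM : ∀ x, x ∉ ball (0 : Eu n) (M + 1) → k (‖x‖ ^ 2) = 0 := fun x hx => by
    have : M + 1 ≤ ‖x‖ := by simpa using hx
    exact h0 x (by linarith)
  have hNe : ∀ᵐ x : Eu n, x ≠ ξ := by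
    have : Nonempty (Fin n) := ⟨⟨0, hn⟩⟩
    simp [ae_iff]
  have I1 := wker_int hn (2 * (p - 1)) hp0 (by linarith) (M + 1) ξ _ ck hkM
  have I2 := wker_int hn (2 * p) (by linarith) (by linarith) (M + 1) ξ g cg hgM
  have T1 : Filter.Tendsto (fun ε : ℝ => ∫ x, k (‖x‖ ^ 2) * (4 * ‖x - ξ‖ ^ 2 *
        (p * ((p - 1) * (‖x - ξ‖ ^ 2 + ε) ^ (p - 1 - 1))) +
        2 * n * (p * (‖x - ξ‖ ^ 2 + ε) ^ (p - 1)))) (nhdsWithin 0 (Ioi 0))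
      (nhds (∫ x, (4 * p * (p - 1) + 2 * n * p) * (k (‖x‖ ^ 2) * ‖x - ξ‖ ^ (2 * (p - 1))))) := by
    refine tendsto_integral_filter_of_dominated_convergence
      (fun x => (4 * |p * (p - 1)| + 2 * n * |p|) * ‖k (‖x‖ ^ 2) * ‖x - ξ‖ ^ (2 * (p - 1))‖) ?_ ?_
      (I1.norm.const_mul _) ?_
    · filter_upwards with ε
      have : Measurable (fun x : Eu n => (4 * ‖x - ξ‖ ^ 2 *
        (p * ((p - 1) * (‖x - ξ‖ ^ 2 + ε) ^ (p - 1 - 1))) +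
        2 * n * (p * (‖x - ξ‖ ^ 2 + ε) ^ (p - 1)))) := by fun_prop
      exact ck.aestronglyMeasurable.mul this.aestronglyMeasurable
    · filter_upwards [self_mem_nhdsWithin] with ε hε
      filter_upwards [hNe] with x hx
      have hε : 0 < ε := hε
      have hs : 0 < ‖x - ξ‖ ^ 2 := by have := norm_pos_iff.2 (sub_ne_zero.2 hx); positivity
      rw [← norm_pow_rpow]
      generalize ‖x - ξ‖ ^ 2 = s at hs ⊢
      rw [norm_mul, norm_mul, mul_left_comm (4 * |p * (p - 1)| + 2 * n * |p|)]
      refine mul_le_mul_of_nonneg_left ?_ (norm_nonneg _)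
      have e1 := reg_bound (p - 1) s ε (by linarith) hs hε
      have e0 : 0 < (s + ε) ^ (p - 1 - 1) := by positivity
      have e2 : s * (s + ε) ^ (p - 1 - 1) ≤ (s + ε) ^ (p - 1) := by
        have : (s + ε) ^ (p - 1) = (s + ε) * (s + ε) ^ (p - 1 - 1) := by
          rw [Real.rpow_sub_one (by positivity) (p - 1)]; field_simp
        rw [this]; nlinarith
      have e3 : 0 < (s + ε) ^ (p - 1) := by positivity
      calc ‖4 * s * (p * ((p - 1) * (s + ε) ^ (p - 1 - 1))) + 2 * n * (p * (s + ε) ^ (p - 1))‖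
          ≤ ‖4 * s * (p * ((p - 1) * (s + ε) ^ (p - 1 - 1)))‖ + ‖2 * n * (p * (s + ε) ^ (p - 1))‖ :=
            norm_add_le _ _
        _ = 4 * |p * (p - 1)| * (s * (s + ε) ^ (p - 1 - 1)) + 2 * n * |p| * (s + ε) ^ (p - 1) := by
            simp only [norm_mul, Real.norm_eq_abs, abs_mul, abs_of_pos e0, abs_of_pos e3,
              abs_of_pos hs, Nat.abs_cast, Nat.abs_ofNat]
            ring
        _ ≤ 4 * |p * (p - 1)| * s ^ (p - 1) + 2 * n * |p| * s ^ (p - 1) := by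
            gcongr
            exact e2.trans e1
        _ = _ := by rw [Real.norm_eq_abs, abs_of_pos (show 0 < s ^ (p - 1) by positivity)]; ring
    · filter_upwards [hNe] with x hx
      have hs : 0 < ‖x - ξ‖ ^ 2 := by have := norm_pos_iff.2 (sub_ne_zero.2 hx); positivity
      rw [← norm_pow_rpow]
      generalize ‖x - ξ‖ ^ 2 = s at hs ⊢
      have : (4 * p * (p - 1) + 2 * n * p) * (k (‖x‖ ^ 2) * s ^ (p - 1)) =
          k (‖x‖ ^ 2) * (4 * s * (p * ((p - 1) * s ^ (p - 1 - 1))) + 2 * n * (p * s ^ (p - 1))) := by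
        rw [Real.rpow_sub_one hs.ne' (p - 1)]; field_simp
      rw [this]
      exact ((((reg_tendsto (p - 1 - 1) s hs).const_mul (p - 1)).const_mul p).const_mul (4 * s)
        |>.add (((reg_tendsto (p - 1) s hs).const_mul p).const_mul (2 * (n : ℝ)))).const_mul _
  have T2 : Filter.Tendsto (fun ε : ℝ => ∫ x, g x * (‖x - ξ‖ ^ 2 + ε) ^ p) (nhdsWithin 0 (Ioi 0))
      (nhds (∫ x, g x * ‖x - ξ‖ ^ (2 * p))) := by
    refine tendsto_integral_filter_of_dominated_convergence
      (fun x => ‖g x * ‖x - ξ‖ ^ (2 * p)‖) ?_ ?_ I2.norm ?_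
    · filter_upwards with ε
      have : Measurable (fun x : Eu n => (‖x - ξ‖ ^ 2 + ε) ^ p) := by fun_prop
      exact cg.aestronglyMeasurable.mul this.aestronglyMeasurable
    · filter_upwards [self_mem_nhdsWithin] with ε hε
      filter_upwards [hNe] with x hx
      have hε : 0 < ε := hε
      have hs : 0 < ‖x - ξ‖ ^ 2 := by have := norm_pos_iff.2 (sub_ne_zero.2 hx); positivity
      rw [← norm_pow_rpow, norm_mul, norm_mul]
      gcongr
      rw [Real.norm_eq_abs, Real.norm_eq_abs, abs_of_pos (by positivity), abs_of_pos (by positivity)]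
      exact reg_bound p _ ε hp hs hε
    · filter_upwards [hNe] with x hx
      have hs : 0 < ‖x - ξ‖ ^ 2 := by have := norm_pos_iff.2 (sub_ne_zero.2 hx); positivity
      rw [← norm_pow_rpow]
      exact (reg_tendsto p _ hs).const_mul _
  rw [← integral_const_mul]
  refine tendsto_nhds_unique T1 (T2.congr' ?_)
  filter_upwards [self_mem_nhdsWithin] with ε hε
  have hε : 0 < ε := hε
  exact (green k k1 k2 (fun s => (s + ε) ^ p) (fun s => p * (s + ε) ^ (p - 1))
    (fun s => p * ((p - 1) * (s + ε) ^ (p - 1 - 1))) M hk hk1 hk2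
    (fun s hs => reg_deriv p ε hε s hs) (fun s hs => (reg_deriv (p - 1) ε hε s hs).const_mul p)
    (continuousOn_const.mul (continuousOn_const.mul (fun s hs =>
      (reg_deriv (p - 1 - 1) ε hε s hs).continuousAt.continuousWithinAt))) h0 h1 h2 ξ).symm

lemma glue_deriv (f g f' g' : ℝ → ℝ) (hf : ∀ s, HasDerivAt f (f' s) s)
    (hg : ∀ s, 0 < s → HasDerivAt g (g' s) s) (h : f 1 = g 1) (h' : f' 1 = g' 1) (s : ℝ) :
    HasDerivAt (fun s => if s ≤ 1 then f s else g s) (if s ≤ 1 then f' s else g' s) s := by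
  rcases lt_trichotomy s 1 with hs | hs | hs
  · rw [if_pos hs.le]
    refine (hf s).congr_of_eventuallyEq ?_
    filter_upwards [Iio_mem_nhds hs] with t ht
    rw [if_pos (le_of_lt ht)]
  · subst hs
    rw [if_pos le_rfl]
    have h1 : HasDerivWithinAt (fun s => if s ≤ 1 then f s else g s) (f' 1) (Iic 1) 1 :=
      (hf 1).hasDerivWithinAt.congr (fun t ht => if_pos ht) (if_pos le_rfl)
    have h2 : HasDerivWithinAt (fun s => if s ≤ 1 then f s else g s) (f' 1) (Ici 1) 1 := by
      rw [h']
      refine (hg 1 one_pos).hasDerivWithinAt.congr (fun t ht => ?_) (by rw [if_pos le_rfl, h])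
      by_cases h3 : t ≤ 1
      · have : t = 1 := le_antisymm h3 ht
        subst this
        rw [if_pos le_rfl, h]
      · rw [if_neg h3]
    have := h1.union h2
    rwa [Iic_union_Ici, hasDerivWithinAt_univ] at this
  · rw [if_neg hs.not_ge]
    refine (hg s (by linarith)).congr_of_eventuallyEq ?_
    filter_upwards [Ioi_mem_nhds hs] with t ht
    rw [if_neg (not_le.2 ht)]

lemma glue_cont (f g : ℝ → ℝ) (hf : Continuous f) (hg : ∀ s, 0 < s → ContinuousAt g s)
    (h : f 1 = g 1) : Continuous (fun s => if s ≤ 1 then f s else g s) := by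
  rw [continuous_iff_continuousAt]
  intro s
  rcases lt_trichotomy s 1 with hs | hs | hs
  · refine (hf.continuousAt (x := s)).congr ?_
    filter_upwards [Iio_mem_nhds hs] with t ht
    rw [if_pos (le_of_lt ht)]
  · subst hs
    have h1 : ContinuousWithinAt (fun s => if s ≤ 1 then f s else g s) (Iic 1) 1 :=
      hf.continuousAt.continuousWithinAt.congr (fun t ht => if_pos ht) (if_pos le_rfl)
    have h2 : ContinuousWithinAt (fun s => if s ≤ 1 then f s else g s) (Ici 1) 1 := by
      refine (hg 1 one_pos).continuousWithinAt.congr (fun t ht => ?_) (by rw [if_pos le_rfl, h])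
      by_cases h3 : t ≤ 1
      · have : t = 1 := le_antisymm h3 ht
        subst this
        rw [if_pos le_rfl, h]
      · rw [if_neg h3]
    have := h1.union h2
    rwa [Iic_union_Ici, continuousWithinAt_univ] at this
  · refine (hg s (by linarith)).congr ?_
    filter_upwards [Ioi_mem_nhds hs] with t ht
    rw [if_neg (not_le.2 ht)]

lemma out_deriv (p s : ℝ) (hs : 0 < s) : HasDerivAt (fun s : ℝ => s ^ p) (p * s ^ (p - 1)) s :=
  Real.hasDerivAt_rpow_const (Or.inl hs.ne')

lemma amgm (N s : ℝ) (m : ℕ) (hN : 0 < N) (hs : 0 < s) :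
    N + 2 * m ≤ 2 * m * s ^ (-(N / 2)) + N * s ^ m := by
  have hD : 0 < N + 2 * m := by positivity
  have h := Real.geom_mean_le_arith_mean2_weighted (w₁ := 2 * m / (N + 2 * m)) (w₂ := N / (N + 2 * m))
    (p₁ := s ^ (-(N / 2))) (p₂ := s ^ m) (by positivity) (by positivity) (by positivity)
    (by positivity) (by field_simp; ring)
  rw [← Real.rpow_natCast, ← Real.rpow_mul hs.le, ← Real.rpow_mul hs.le, ← Real.rpow_add hs] at h
  have e : -(N / 2) * (2 * m / (N + 2 * m)) + m * (N / (N + 2 * m)) = 0 := by field_simp; ring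
  rw [e, Real.rpow_zero, Real.rpow_natCast] at h
  have : 2 * m / (N + 2 * m) * s ^ (-(N / 2)) + N / (N + 2 * m) * s ^ m =
    (2 * m * s ^ (-(N / 2)) + N * s ^ m) / (N + 2 * m) := by field_simp
  rw [this, le_div_iff₀ hD] at h
  linarith

lemma test_fn (N : ℝ) (hN : 5 ≤ N) (m : ℕ) (hm : 1 ≤ m) : ∃ (h h1 h2 : ℝ → ℝ),
    (∀ s, HasDerivAt h (h1 s) s) ∧ (∀ s, HasDerivAt h1 (h2 s) s) ∧ Continuous h2 ∧
    (∀ s, 0 ≤ s → 4 * s * h2 s + 2 * N * h1 s = -(if s ≤ 1 then 1 - s ^ m else 0)) ∧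
    (∀ s, 1 ≤ s → h s = 2 * m / (N * (N - 2) * (N + 2 * m)) * s ^ (1 - N / 2)) ∧
    (∀ s, 1 ≤ s → h1 s = -(m / (N * (N + 2 * m))) * s ^ (-(N / 2))) ∧
    (∀ s, 1 ≤ s → h2 s = m / (N * (N + 2 * m)) * (N / 2) * s ^ (-(N / 2) - 1)) ∧
    (∀ s, 0 ≤ s → s ≤ 1 → 2 * m / (N * (N - 2) * (N + 2 * m)) ≤ h s ∧ h s ≤ 1) ∧
    (∀ s, 0 < s → s ≤ 1 → h s ≤ 2 * m / (N * (N - 2) * (N + 2 * m)) * s ^ (1 - N / 2)) := by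
  have hm1 : (1 : ℝ) ≤ m := by exact_mod_cast hm
  have hN2 : 0 < N - 2 := by linarith
  have hN0 : 0 < N := by linarith
  have hD : 0 < N + 2 * m := by positivity
  obtain ⟨j, rfl⟩ : ∃ j, m = j + 1 := ⟨m - 1, by omega⟩
  set m := j + 1 with hmdef
  set K : ℝ := 2 * m / (N * (N - 2) * (N + 2 * m)) with hK
  set K1 : ℝ := m / (N * (N + 2 * m)) with hK1
  have hKK : K * (1 - N / 2) = -K1 := by rw [hK, hK1]; field_simp; ring
  set C0 : ℝ := K + 1 / (2 * N) - 1 / (2 * (m + 1) * (N + 2 * m)) with hC0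
  set i0 : ℝ → ℝ := fun s => C0 - s / (2 * N) + s ^ (m + 1) / (2 * (m + 1) * (N + 2 * m)) with hi0
  set i1 : ℝ → ℝ := fun s => -(1 / (2 * N)) + s ^ m / (2 * (N + 2 * m)) with hi1
  set i2 : ℝ → ℝ := fun s => m * s ^ j / (2 * (N + 2 * m)) with hi2
  set o0 : ℝ → ℝ := fun s => K * s ^ (1 - N / 2) with ho0
  set o1 : ℝ → ℝ := fun s => -K1 * s ^ (-(N / 2)) with ho1
  set o2 : ℝ → ℝ := fun s => K1 * (N / 2) * s ^ (-(N / 2) - 1) with ho2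
  have di0 : ∀ s, HasDerivAt i0 (i1 s) s := fun s => by
    have := (((hasDerivAt_id s).div_const (2 * N)).const_sub C0).add
      ((hasDerivAt_pow (m + 1) s).div_const (2 * (m + 1) * (N + 2 * m)))
    convert! this using 1
    simp only [hi1, Nat.add_sub_cancel]
    push_cast
    field_simp
  have di1 : ∀ s, HasDerivAt i1 (i2 s) s := fun s => by
    have := ((hasDerivAt_pow m s).div_const (2 * (N + 2 * m))).const_add (-(1 / (2 * N)))
    convert! this using 1
  have do0 : ∀ s, 0 < s → HasDerivAt o0 (o1 s) s := fun s hs => by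
    convert! (out_deriv (1 - N / 2) s hs).const_mul K using 1
    rw [← mul_assoc, hKK, show 1 - N / 2 - 1 = -(N / 2) by ring]
  have do1 : ∀ s, 0 < s → HasDerivAt o1 (o2 s) s := fun s hs => by
    convert! (out_deriv (-(N / 2)) s hs).const_mul (-K1) using 1
    simp only [ho2]; ring
  have g0 : i0 1 = o0 1 := by simp only [hi0, ho0, hC0, Real.one_rpow, one_pow]; ring
  have g1 : i1 1 = o1 1 := by
    simp only [hi1, ho1, hK1, Real.one_rpow, one_pow]; field_simp; ring
  have g2 : i2 1 = o2 1 := by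
    simp only [hi2, ho2, hK1, Real.one_rpow, one_pow]; field_simp
  have ext : ∀ (f g : ℝ → ℝ), f 1 = g 1 → ∀ s, 1 ≤ s → (if s ≤ 1 then f s else g s) = g s := by
    intro f g hfg s hs
    by_cases h3 : s ≤ 1
    · have : s = 1 := le_antisymm h3 hs
      subst this
      rw [if_pos le_rfl, hfg]
    · rw [if_neg h3]
  refine ⟨fun s => if s ≤ 1 then i0 s else o0 s, fun s => if s ≤ 1 then i1 s else o1 s,
    fun s => if s ≤ 1 then i2 s else o2 s, glue_deriv _ _ _ _ di0 do0 g0 g1,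
    glue_deriv _ _ _ _ di1 do1 g1 g2, glue_cont _ _ ?_ ?_ g2, ?_, ext _ _ g0, ext _ _ g1, ext _ _ g2, ?_, ?_⟩
  · simp only [hi2]; fun_prop
  · intro s hs
    exact continuousAt_const.mul (out_deriv _ s hs).continuousAt
  · intro s hs
    by_cases h : s ≤ 1
    · simp only [if_pos h, hi1, hi2, hmdef, pow_succ]
      push_cast
      push_cast [hmdef] at hD
      field_simp
      ring
    · simp only [if_neg h, ho1, ho2]
      have : 0 < s := by linarith
      rw [Real.rpow_sub_one this.ne']
      field_simp
      ring
  · intro s hs h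
    simp only [if_pos h, hi0, hC0]
    have hb : 1 + ((m + 1 : ℕ) : ℝ) * (s - 1) ≤ (1 + (s - 1)) ^ (m + 1) :=
      one_add_mul_le_pow (by linarith) _
    rw [show 1 + (s - 1) = s by ring] at hb
    push_cast at hb
    have hs1 : s ^ (m + 1) ≤ 1 := pow_le_one₀ hs h
    have e1 : (1 - s ^ (m + 1)) / (2 * (m + 1) * (N + 2 * m)) ≤ (1 - s) / (2 * N) := by
      rw [div_le_div_iff₀ (by positivity) (by positivity)]
      have : 0 ≤ (1 - s) * m * (m + 1) := mul_nonneg (mul_nonneg (by linarith) (by positivity)) (by positivity)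
      nlinarith
    have e2 : 0 ≤ (1 - s ^ (m + 1)) / (2 * (m + 1) * (N + 2 * m)) :=
      div_nonneg (by linarith) (by positivity)
    have e3 : (1 - s) / (2 * N) ≤ 1 / 2 := by
      rw [div_le_div_iff₀ (by positivity) (by positivity)]; nlinarith
    have e4 : K ≤ 1 / 2 := by
      rw [hK, div_le_div_iff₀ (by positivity) (by positivity)]
      have : 2 ≤ N * (N - 2) := by nlinarith
      nlinarith
    have e5 : K + 1 / (2 * N) - 1 / (2 * (m + 1) * (N + 2 * m)) - s / (2 * N) +
      s ^ (m + 1) / (2 * (m + 1) * (N + 2 * m)) = K + (1 - s) / (2 * N) -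
      (1 - s ^ (m + 1)) / (2 * (m + 1) * (N + 2 * m)) := by ring
    rw [e5]
    constructor <;> linarith
  · intro s hs h
    simp only [if_pos h]
    have anti : AntitoneOn (fun t => o0 t - i0 t) (Icc s 1) := by
      have hd : ∀ t, 0 < t → HasDerivAt (fun t => o0 t - i0 t) (o1 t - i1 t) t :=
        fun t ht => (do0 t ht).sub (di0 t)
      refine antitoneOn_of_deriv_nonpos (convex_Icc _ _)
        (fun t ht => (hd t (by linarith [ht.1])).continuousAt.continuousWithinAt)
        (fun t ht => ?_) (fun t ht => ?_)
      · rw [interior_Icc] at ht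
        exact (hd t (by linarith [ht.1])).differentiableAt.differentiableWithinAt
      · rw [interior_Icc] at ht
        have ht0 : 0 < t := by linarith [ht.1]
        rw [(hd t ht0).deriv]
        have := amgm N t m hN0 ht0
        have e : o1 t - i1 t = -(2 * m * t ^ (-(N / 2)) + N * t ^ m - (N + 2 * m)) / (2 * N * (N + 2 * m)) := by
          simp only [ho1, hi1, hK1]; field_simp; ring
        rw [e]
        exact div_nonpos_of_nonpos_of_nonneg (by linarith) (by positivity)
    have := anti (left_mem_Icc.2 h) (right_mem_Icc.2 h) h
    simp only [g0, sub_self] at this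
    have e : o0 s = K * s ^ (1 - N / 2) := rfl
    linarith

noncomputable def etaF (m : ℕ) (s : ℝ) : ℝ := if s ≤ 1 then 1 - s ^ m else 0

lemma cut_fn (n : ℕ) (hn : 5 ≤ n) (m : ℕ) (hm : 3 * n ≤ m) : ∃ (k k1 k2 : ℝ → ℝ),
    (∀ s, HasDerivAt k (k1 s) s) ∧ (∀ s, HasDerivAt k1 (k2 s) s) ∧ Continuous k2 ∧
    (∀ s, (m : ℝ) ^ 2 ≤ s → k s = 0) ∧ (∀ s, (m : ℝ) ^ 2 ≤ s → k1 s = 0) ∧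
    (∀ s, (m : ℝ) ^ 2 ≤ s → k2 s = 0) ∧
    (∀ s, 0 ≤ s → 4 * s * k2 s + 2 * n * k1 s = -(etaF m s - ((m : ℝ) ^ n)⁻¹ * etaF m (s / (m : ℝ) ^ 2))) ∧
    (∀ s, 0 ≤ s → 0 ≤ k s) ∧ (∀ s, 0 ≤ s → s ≤ 1 → 1 / (2 * n * (n + 2)) ≤ k s) := by
  obtain ⟨h, h1, h2, d0, d1, c2, hL, o0, o1, o2, hb, hle⟩ := test_fn n (by exact_mod_cast hn) m (by omega)
  have hN : (5 : ℝ) ≤ n := by exact_mod_cast hn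
  have hmN : 3 * (n : ℝ) ≤ m := by exact_mod_cast hm
  have hm0 : (0 : ℝ) < m := by linarith
  set N : ℝ := (n : ℝ) with hNdef
  set K : ℝ := 2 * m / (N * (N - 2) * (N + 2 * m)) with hK
  set K1 : ℝ := m / (N * (N + 2 * m)) with hK1
  set T : ℝ := (m : ℝ) ^ 2 with hT
  have hT0 : 0 < T := by positivity
  have hT1 : 1 ≤ T := by rw [hT]; nlinarith
  have hTn : T ^ (-(N / 2)) = ((m : ℝ) ^ n)⁻¹ := by
    rw [hT, ← Real.rpow_natCast_mul hm0.le, ← Real.rpow_natCast, ← Real.rpow_neg hm0.le]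
    congr 1; push_cast; rw [← hNdef]; ring
  have hmulT : ∀ p s : ℝ, 1 ≤ s / T → T ^ p * (s / T) ^ p = s ^ p := fun p s hs => by
    rw [← Real.mul_rpow hT0.le (by linarith)]; congr 1; field_simp
  have hN2 : 0 < N - 2 := by linarith
  have hD : 0 < N + 2 * m := by positivity
  have hKlow : 2 / (3 * (N * (N - 2))) ≤ K := by
    rw [hK, div_le_div_iff₀ (by positivity) (by positivity)]
    have : 0 < N * (N - 2) := by positivity
    nlinarith
  have hTsmall : T ^ (1 - N / 2) ≤ K - 1 / (2 * N * (N + 2)) := by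
    have e1 : T ^ (1 - N / 2) ≤ T ^ (-1 : ℝ) := Real.rpow_le_rpow_of_exponent_le hT1 (by linarith)
    have e2 : T ^ (-1 : ℝ) ≤ 1 / (6 * (N * (N - 2))) := by
      rw [Real.rpow_neg_one, ← one_div, div_le_div_iff₀ (by positivity) (by positivity), hT]
      nlinarith
    have e3 : 1 / (2 * N * (N + 2)) ≤ 1 / (2 * (N * (N - 2))) := by
      apply one_div_le_one_div_of_le (by positivity); nlinarith
    have e4 : 2 / (3 * (N * (N - 2))) - 1 / (2 * (N * (N - 2))) = 1 / (6 * (N * (N - 2))) := by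
      field_simp; norm_num
    linarith
  have hlow : ∀ s, 0 ≤ s → s ≤ 1 → 1 / (2 * N * (N + 2)) ≤ h s - T ^ (1 - N / 2) * h (s / T) := by
    intro s hs hs1
    have a1 := (hb s hs hs1).1
    have a2 := (hb (s / T) (by positivity) (by rw [div_le_one hT0]; linarith)).2
    have a3 : 0 < T ^ (1 - N / 2) := by positivity
    nlinarith
  have hsd : ∀ s : ℝ, T ≤ s → 1 ≤ s / T := fun s hs => by rwa [one_le_div hT0]
  refine ⟨fun s => h s - T ^ (1 - N / 2) * h (s / T), fun s => h1 s - T ^ (-(N / 2)) * h1 (s / T),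
    fun s => h2 s - T ^ (-(N / 2) - 1) * h2 (s / T), ?_, ?_, ?_, ?_, ?_, ?_, ?_, ?_, hlow⟩
  · intro s
    have := (d0 s).sub (((d0 (s / T)).comp s ((hasDerivAt_id s).div_const T)).const_mul (T ^ (1 - N / 2)))
    convert! this using 1
    rw [show 1 - N / 2 = -(N / 2) + 1 by ring, Real.rpow_add_one hT0.ne']
    field_simp
  · intro s
    have := (d1 s).sub (((d1 (s / T)).comp s ((hasDerivAt_id s).div_const T)).const_mul (T ^ (-(N / 2))))
    convert! this using 1
    rw [Real.rpow_sub_one hT0.ne']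
    field_simp
  · exact c2.sub (continuous_const.mul (c2.comp (continuous_id.div_const T)))
  · intro s hs
    have e := hmulT (1 - N / 2) s (hsd s hs)
    simp only [o0 s (hT1.trans hs), o0 (s / T) (hsd s hs)]
    rw [← e]; ring
  · intro s hs
    have e := hmulT (-(N / 2)) s (hsd s hs)
    simp only [o1 s (hT1.trans hs), o1 (s / T) (hsd s hs)]
    rw [← e]; ring
  · intro s hs
    have e := hmulT (-(N / 2) - 1) s (hsd s hs)
    simp only [o2 s (hT1.trans hs), o2 (s / T) (hsd s hs)]
    rw [← e]; ring
  · intro s hs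
    have a1 := hL s hs
    have a2 := hL (s / T) (by positivity)
    simp only [etaF]
    rw [← hTn, Real.rpow_sub_one hT0.ne']
    calc _ = (4 * s * h2 s + 2 * N * h1 s) -
          T ^ (-(N / 2)) * (4 * (s / T) * h2 (s / T) + 2 * N * h1 (s / T)) := by field_simp; ring
      _ = _ := by rw [a1, a2]; ring
  · intro s hs
    show 0 ≤ h s - T ^ (1 - N / 2) * h (s / T)
    rcases le_total s 1 with h3 | h3
    · exact le_trans (by positivity) (hlow s hs h3)
    · rw [o0 s h3]
      have e : T ^ (1 - N / 2) * (s / T) ^ (1 - N / 2) = s ^ (1 - N / 2) := by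
        rw [← Real.mul_rpow hT0.le (by positivity)]; congr 1; field_simp
      have a3 : 0 < T ^ (1 - N / 2) := by positivity
      have a4 : h (s / T) ≤ K * (s / T) ^ (1 - N / 2) := by
        rcases le_total (s / T) 1 with h4 | h4
        · exact hle _ (by positivity) h4
        · exact (o0 _ h4).le
      have := mul_le_mul_of_nonneg_left a4 a3.le
      rw [← e]; linarith

lemma ind_norm {n : ℕ} (R : ℝ) (x : Eu n) (g : ℝ) :
    (Iio R).indicator (1 : ℝ → ℝ) ‖x‖ * g = (ball (0 : Eu n) R).indicator (fun _ => g) x := by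
  by_cases h : ‖x‖ < R
  · rw [indicator_of_mem (show ‖x‖ ∈ Iio R from h), indicator_of_mem (by simpa using h)]; simp
  · rw [indicator_of_notMem (show ‖x‖ ∉ Iio R from h), indicator_of_notMem (by simpa using h)]; simp

lemma ind_int {n : ℕ} (R : ℝ) :
    Integrable (fun x : Eu n => (Iio R).indicator (1 : ℝ → ℝ) ‖x‖) := by
  have h : (fun x : Eu n => (Iio R).indicator (1 : ℝ → ℝ) ‖x‖) =
      (ball (0 : Eu n) R).indicator (fun _ => (1 : ℝ)) := by
    ext x; rw [← ind_norm, mul_one]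
  rw [h]
  exact (integrable_indicator_iff measurableSet_ball).2 (integrableOn_const measure_ball_lt_top.ne)

lemma ind_val {n : ℕ} (R : ℝ) (hR : 0 < R) :
    ∫ x : Eu n, (Iio R).indicator (1 : ℝ → ℝ) ‖x‖ = R ^ n * volume.real (ball (0 : Eu n) 1) := by
  have h : (fun x : Eu n => (Iio R).indicator (1 : ℝ → ℝ) ‖x‖) =
      (ball (0 : Eu n) R).indicator (fun _ => (1 : ℝ)) := by
    ext x; rw [← ind_norm, mul_one]
  rw [h, integral_indicator measurableSet_ball]
  simp only [integral_const, smul_eq_mul, mul_one, MeasurableSet.univ, measureReal_restrict_apply, univ_inter]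
  rw [measureReal_def, measureReal_def, Measure.addHaar_ball_of_pos _ _ hR]
  simp [hR.le]

lemma phi_nonneg {n : ℕ} (hn : 1 ≤ n) {μ : Measure (Eu n)} [IsProbabilityMeasure μ]
    (hμ : ∀ᵐ θ ∂μ, ‖θ‖ = 1)
    (hL : ∀ L : Eu n ≃ₗᵢ[ℝ] Eu n, MeasurePreserving L μ μ)
    (γ : ℝ) (h0 : -(n : ℝ) < γ) (h1 : γ < 0) (f : Eu n → ℝ)
    (hf : Integrable f) (hf1 : ∀ x, |f x| ≤ 1)
    (hanti : AntitoneOn (fun r : ℝ => ∫ θ, (∫ ξ, f ξ * ‖r • θ - ξ‖ ^ γ) ∂μ) (Ioi 0))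
    (r : ℝ) (hr : 0 < r) : 0 ≤ ∫ θ, (∫ ξ, f ξ * ‖r • θ - ξ‖ ^ γ) ∂μ := by
  set φ : ℝ → ℝ := fun r : ℝ => ∫ θ, (∫ ξ, f ξ * ‖r • θ - ξ‖ ^ γ) ∂μ with hφ
  by_contra hneg
  push Not at hneg
  change φ r < 0 at hneg
  set δ := - φ r with hδ
  have hδ0 : 0 < δ := by linarith
  obtain ⟨C, hC, hCb⟩ := ker_ball_scale hn γ h0 h1.le
  set F : ℝ → ℝ → ℝ := fun R => (Iio R).indicator (1 : ℝ → ℝ) with hF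
  have hFm : ∀ R, Measurable (F R) := fun R => measurable_one.indicator measurableSet_Iio
  have hF0 : ∀ R t, 0 ≤ F R t := fun R t => indicator_nonneg (fun _ _ => by simp) _
  have hP := fun R => pot_avg hn hμ hL γ h0 h1.le f hf hf1 (F R) (hFm R) (hF0 R) (ind_int R)
  have hA : ∀ R, Integrable (fun x : Eu n => F R ‖x‖ * φ ‖x‖) := fun R => (hP R).2.2
  have hval : ∀ R, ∫ x : Eu n, F R ‖x‖ * φ ‖x‖ = ∫ ξ, f ξ * ∫ x, F R ‖x‖ * ‖x - ξ‖ ^ γ :=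
    fun R => (hP R).1.symm.trans (hP R).2.1
  set v := volume.real (ball (0 : Eu n) 1) with hv
  have hv0 : 0 < v := by
    rw [hv, measureReal_def]
    exact ENNReal.toReal_pos (measure_ball_pos _ _ one_pos).ne' measure_ball_lt_top.ne
  have hlow : ∀ R, 0 < R → -((∫ ξ, |f ξ|) * (C * R ^ n * R ^ γ)) ≤ ∫ x : Eu n, F R ‖x‖ * φ ‖x‖ := by
    intro R hR
    rw [hval]
    have hin : ∀ ξ, ∫ x, F R ‖x‖ * ‖x - ξ‖ ^ γ = ∫ x in ball (0 : Eu n) R, ‖x - ξ‖ ^ γ := by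
      intro ξ
      rw [← integral_indicator measurableSet_ball]
      congr 1; ext x; simp only [hF, ind_norm]
      by_cases h : x ∈ ball (0 : Eu n) R <;> simp [indicator, h]
    have hb : ‖∫ ξ, f ξ * ∫ x, F R ‖x‖ * ‖x - ξ‖ ^ γ‖ ≤ ∫ ξ, |f ξ| * (C * R ^ n * R ^ γ) := by
      refine norm_integral_le_of_norm_le (hf.abs.mul_const _) (Filter.Eventually.of_forall fun ξ => ?_)
      rw [norm_mul, hin, Real.norm_eq_abs]
      refine mul_le_mul_of_nonneg_left ?_ (abs_nonneg _)
      rw [Real.norm_eq_abs, abs_of_nonneg (integral_nonneg fun x => by positivity)]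
      exact hCb ξ R hR
    rw [integral_mul_const, Real.norm_eq_abs] at hb
    linarith [(abs_le.1 hb).1]
  have hup : ∀ R, r ≤ R → ∫ x : Eu n, F R ‖x‖ * φ ‖x‖ ≤
      (∫ x : Eu n, F r ‖x‖ * φ ‖x‖) - δ * (R ^ n * v - r ^ n * v) := by
    intro R hR
    have hI2 : Integrable (fun x : Eu n => δ * ((Iio R).indicator (1 : ℝ → ℝ) ‖x‖ -
        (Iio r).indicator (1 : ℝ → ℝ) ‖x‖)) := ((ind_int R).sub (ind_int r)).const_mul δ
    rw [← ind_val R (by linarith), ← ind_val r hr, ← integral_sub (ind_int R) (ind_int r),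
      ← integral_const_mul, ← integral_sub (hA r) hI2]
    refine integral_mono (hA R) ((hA r).sub hI2) fun x => ?_
    simp only [hF, Pi.sub_apply]
    by_cases h3 : ‖x‖ < r
    · rw [indicator_of_mem (show ‖x‖ ∈ Iio r from h3), indicator_of_mem (show ‖x‖ ∈ Iio R from h3.trans_le hR)]
      simp
    · rw [indicator_of_notMem (show ‖x‖ ∉ Iio r from h3)]
      have h4 : φ ‖x‖ ≤ φ r := hanti hr (lt_of_lt_of_le hr (not_lt.1 h3)) (not_lt.1 h3)
      by_cases h5 : ‖x‖ < R
      · rw [indicator_of_mem (show ‖x‖ ∈ Iio R from h5)]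
        simp only [Pi.one_apply]; linarith
      · rw [indicator_of_notMem (show ‖x‖ ∉ Iio R from h5)]
        simp
  set A0 := ∫ x : Eu n, F r ‖x‖ * φ ‖x‖ with hA0
  set I := ∫ ξ, |f ξ| with hI
  have key : ∀ R, r ≤ R → δ * v ≤ (A0 + δ * (r ^ n * v)) * (R ^ n)⁻¹ + I * C * R ^ γ := by
    intro R hR
    have hR0 : 0 < R := by linarith
    have a1 := hlow R hR0
    have a2 := hup R hR
    have a3 : 0 < R ^ n := by positivity
    have a4 : δ * v * R ^ n ≤ (A0 + δ * (r ^ n * v)) + I * C * R ^ γ * R ^ n := by linarith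
    have a5 := mul_le_mul_of_nonneg_right a4 (inv_pos.2 a3).le
    calc δ * v = δ * v * R ^ n * (R ^ n)⁻¹ := by field_simp
      _ ≤ _ := a5
      _ = _ := by field_simp
  have t1 : Filter.Tendsto (fun R : ℝ => (R ^ n)⁻¹) Filter.atTop (nhds 0) :=
    (Filter.tendsto_pow_atTop (by omega)).inv_tendsto_atTop
  have t2 : Filter.Tendsto (fun R : ℝ => R ^ γ) Filter.atTop (nhds 0) := by
    simpa using tendsto_rpow_neg_atTop (y := -γ) (by linarith)
  have t3 := (t1.const_mul (A0 + δ * (r ^ n * v))).add (t2.const_mul (I * C))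
  rw [mul_zero, mul_zero, add_zero] at t3
  have := ge_of_tendsto t3 (Filter.eventually_atTop.2 ⟨r, key⟩)
  nlinarith [mul_pos hδ0 hv0]

lemma eta_le (m : ℕ) (s : ℝ) (hs : 0 ≤ s) : 0 ≤ etaF m s ∧ etaF m s ≤ 1 := by
  unfold etaF
  split_ifs with h
  · have h1 := pow_le_one₀ (n := m) hs h
    have h2 : 0 ≤ s ^ m := by positivity
    constructor <;> linarith
  · constructor <;> norm_num

lemma eta_out (m : ℕ) (s : ℝ) (hs : 1 ≤ s) : etaF m s = 0 := by
  unfold etaF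
  split_ifs with h
  · have : s = 1 := le_antisymm h hs
    simp [this]
  · rfl

lemma eta_meas (m : ℕ) : Measurable (etaF m) :=
  Measurable.ite measurableSet_Iic (by fun_prop) measurable_const

lemma eta_pt {n : ℕ} (γ : ℝ) (m : ℕ) (R : ℝ) (hR : 0 < R) (ξ x : Eu n) :
    0 ≤ etaF m (‖x‖ ^ 2 / R ^ 2) * ‖x - ξ‖ ^ γ ∧ etaF m (‖x‖ ^ 2 / R ^ 2) * ‖x - ξ‖ ^ γ ≤
      (ball (0 : Eu n) R).indicator (fun x => ‖x - ξ‖ ^ γ) x := by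
  have hk : 0 ≤ ‖x - ξ‖ ^ γ := by positivity
  have he := eta_le m (‖x‖ ^ 2 / R ^ 2) (by positivity)
  refine ⟨mul_nonneg he.1 hk, ?_⟩
  by_cases h : x ∈ ball (0 : Eu n) R
  · rw [indicator_of_mem h]; nlinarith
  · rw [indicator_of_notMem h]
    have : R ≤ ‖x‖ := by simpa using h
    rw [eta_out m _ (by rw [one_le_div (by positivity)]; gcongr), zero_mul]

lemma eta_ker {n : ℕ} (hn : 1 ≤ n) (γ : ℝ) (h0 : -(n : ℝ) < γ) (h1 : γ ≤ 0) (m : ℕ) (R : ℝ)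
    (hR : 0 < R) (ξ : Eu n) :
    Integrable (fun x : Eu n => etaF m (‖x‖ ^ 2 / R ^ 2) * ‖x - ξ‖ ^ γ) ∧
    0 ≤ ∫ x : Eu n, etaF m (‖x‖ ^ 2 / R ^ 2) * ‖x - ξ‖ ^ γ ∧
    ∫ x : Eu n, etaF m (‖x‖ ^ 2 / R ^ 2) * ‖x - ξ‖ ^ γ ≤ ∫ x in ball (0 : Eu n) R, ‖x - ξ‖ ^ γ := by
  have hi := (integrable_indicator_iff measurableSet_ball).2 (ker_ball_int hn γ h0 h1 R ξ)
  have hI : Integrable (fun x : Eu n => etaF m (‖x‖ ^ 2 / R ^ 2) * ‖x - ξ‖ ^ γ) := by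
    refine hi.mono' ?_ (Filter.Eventually.of_forall fun x => ?_)
    · have := eta_meas m
      exact (by fun_prop : Measurable (fun x : Eu n => etaF m (‖x‖ ^ 2 / R ^ 2) * ‖x - ξ‖ ^ γ)).aestronglyMeasurable
    · rw [Real.norm_eq_abs, abs_of_nonneg (eta_pt γ m R hR ξ x).1]
      exact (eta_pt γ m R hR ξ x).2
  refine ⟨hI, integral_nonneg fun x => (eta_pt γ m R hR ξ x).1, ?_⟩
  rw [← integral_indicator measurableSet_ball]
  exact integral_mono hI hi fun x => (eta_pt γ m R hR ξ x).2

lemma eta_lim {n : ℕ} (hn : 1 ≤ n) (γ : ℝ) (h0 : -(n : ℝ) < γ) (h1 : γ ≤ 0) (ξ : Eu n) :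
    Filter.Tendsto (fun m : ℕ => ∫ x : Eu n, etaF m (‖x‖ ^ 2 / 1 ^ 2) * ‖x - ξ‖ ^ γ) Filter.atTop
      (nhds (∫ x in ball (0 : Eu n) 1, ‖x - ξ‖ ^ γ)) := by
  have hi := (integrable_indicator_iff measurableSet_ball).2 (ker_ball_int hn γ h0 h1 1 ξ)
  rw [← integral_indicator measurableSet_ball]
  refine tendsto_integral_of_dominated_convergence _
    (fun m => (eta_ker hn γ h0 h1 m 1 one_pos ξ).1.aestronglyMeasurable) hi
    (fun m => Filter.Eventually.of_forall fun x => ?_) (Filter.Eventually.of_forall fun x => ?_)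
  · rw [Real.norm_eq_abs, abs_of_nonneg (eta_pt γ m 1 one_pos ξ x).1]
    exact (eta_pt γ m 1 one_pos ξ x).2
  · by_cases h : x ∈ ball (0 : Eu n) 1
    · rw [indicator_of_mem h]
      have hx : ‖x‖ < 1 := by simpa using h
      have hs : ‖x‖ ^ 2 / 1 ^ 2 < 1 := by
        rw [one_pow, div_one]; exact pow_lt_one₀ (norm_nonneg _) hx (by norm_num)
      have e : (fun m : ℕ => etaF m (‖x‖ ^ 2 / 1 ^ 2) * ‖x - ξ‖ ^ γ) =
          fun m : ℕ => (1 - (‖x‖ ^ 2 / 1 ^ 2) ^ m) * ‖x - ξ‖ ^ γ := by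
        ext m; simp only [etaF, if_pos hs.le]
      rw [e]
      have := ((tendsto_pow_atTop_nhds_zero_of_lt_one (by positivity) hs).const_sub 1).mul_const (‖x - ξ‖ ^ γ)
      simpa using this
    · rw [indicator_of_notMem h]
      have hx : 1 ≤ ‖x‖ := by simpa using h
      have e : (fun m : ℕ => etaF m (‖x‖ ^ 2 / 1 ^ 2) * ‖x - ξ‖ ^ γ) = fun _ => 0 := by
        ext m; rw [eta_out m _ (by rw [one_pow, div_one]; exact one_le_pow₀ hx), zero_mul]
      rw [e]
      exact tendsto_const_nhds

lemma eta_ker_meas {n : ℕ} (γ : ℝ) (m : ℕ) (R : ℝ) :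
    StronglyMeasurable (fun ξ : Eu n => ∫ x : Eu n, etaF m (‖x‖ ^ 2 / R ^ 2) * ‖x - ξ‖ ^ γ) := by
  have := eta_meas m
  have : StronglyMeasurable (fun p : Eu n × Eu n => etaF m (‖p.2‖ ^ 2 / R ^ 2) * ‖p.2 - p.1‖ ^ γ) :=
    (by fun_prop : Measurable _).stronglyMeasurable
  exact this.integral_prod_right'

lemma outer_lim {n : ℕ} (hn : 1 ≤ n) (γ : ℝ) (h0 : -(n : ℝ) < γ) (h1 : γ < 0) (f : Eu n → ℝ)
    (hf : Integrable f) :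
    Filter.Tendsto (fun m : ℕ => ∫ ξ : Eu n, f ξ * ((∫ x : Eu n, etaF m (‖x‖ ^ 2 / 1 ^ 2) * ‖x - ξ‖ ^ γ) -
      ((m : ℝ) ^ n)⁻¹ * ∫ x : Eu n, etaF m (‖x‖ ^ 2 / (m : ℝ) ^ 2) * ‖x - ξ‖ ^ γ)) Filter.atTop
      (nhds (∫ ξ : Eu n, f ξ * ∫ x in ball (0 : Eu n) 1, ‖x - ξ‖ ^ γ)) := by
  obtain ⟨C, hC, hCb⟩ := ker_ball_scale hn γ h0 h1.le
  have hN1 : ∀ (m : ℕ) (ξ : Eu n), |∫ x : Eu n, etaF m (‖x‖ ^ 2 / 1 ^ 2) * ‖x - ξ‖ ^ γ| ≤ C := by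
    intro m ξ
    have := eta_ker hn γ h0 h1.le m 1 one_pos ξ
    rw [abs_of_nonneg this.2.1]
    have h2 := hCb ξ 1 one_pos
    rw [one_pow, Real.one_rpow, mul_one, mul_one] at h2
    exact this.2.2.trans h2
  have hN2 : ∀ (m : ℕ) (ξ : Eu n), 1 ≤ m →
      |((m : ℝ) ^ n)⁻¹ * ∫ x : Eu n, etaF m (‖x‖ ^ 2 / (m : ℝ) ^ 2) * ‖x - ξ‖ ^ γ| ≤ C * (m : ℝ) ^ γ := by
    intro m ξ hm
    have hm0 : (0 : ℝ) < m := by exact_mod_cast hm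
    have := eta_ker hn γ h0 h1.le m m hm0 ξ
    rw [abs_of_nonneg (mul_nonneg (by positivity) this.2.1)]
    calc _ ≤ ((m : ℝ) ^ n)⁻¹ * (C * (m : ℝ) ^ n * (m : ℝ) ^ γ) := by
          refine mul_le_mul_of_nonneg_left (this.2.2.trans (hCb ξ m hm0)) (by positivity)
      _ = _ := by field_simp
  have t2 : Filter.Tendsto (fun m : ℕ => C * (m : ℝ) ^ γ) Filter.atTop (nhds 0) := by
    have : Filter.Tendsto (fun R : ℝ => R ^ γ) Filter.atTop (nhds 0) := by
      simpa using tendsto_rpow_neg_atTop (y := -γ) (by linarith)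
    simpa using (this.comp tendsto_natCast_atTop_atTop).const_mul C
  refine tendsto_integral_filter_of_dominated_convergence (fun ξ => |f ξ| * (C + C)) ?_ ?_
    (hf.abs.mul_const _) ?_
  · filter_upwards with m
    exact hf.1.mul ((eta_ker_meas γ m 1).sub
      ((eta_ker_meas γ m m).const_mul _)).aestronglyMeasurable
  · filter_upwards [Filter.eventually_ge_atTop 1] with m hm
    filter_upwards with ξ
    rw [norm_mul, Real.norm_eq_abs, Real.norm_eq_abs]
    refine mul_le_mul_of_nonneg_left ((abs_sub _ _).trans (add_le_add (hN1 m ξ) ((hN2 m ξ hm).trans ?_))) (abs_nonneg _)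
    have : (m : ℝ) ^ γ ≤ 1 := Real.rpow_le_one_of_one_le_of_nonpos (by exact_mod_cast hm) h1.le
    nlinarith
  · filter_upwards with ξ
    have a := (eta_lim hn γ h0 h1.le ξ).sub (squeeze_zero_norm' (a := fun m : ℕ => C * (m : ℝ) ^ γ)
      (f := fun m : ℕ => ((m : ℝ) ^ n)⁻¹ * ∫ x : Eu n, etaF m (‖x‖ ^ 2 / (m : ℝ) ^ 2) * ‖x - ξ‖ ^ γ)
      (by filter_upwards [Filter.eventually_ge_atTop 1] with m hm; exact hN2 m ξ hm) t2)
    rw [sub_zero] at a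
    exact a.const_mul _

lemma main_ineq {n : ℕ} (hn : 5 ≤ n) {μ : Measure (Eu n)} [IsProbabilityMeasure μ]
    (hμ : ∀ᵐ θ ∂μ, ‖θ‖ = 1)
    (hL : ∀ L : Eu n ≃ₗᵢ[ℝ] Eu n, MeasurePreserving L μ μ)
    (p : ℝ) (hp0 : -(n : ℝ) < 2 * (p - 1)) (hp : p < 0)
    (hκ : 0 ≤ -(4 * p * (p - 1) + 2 * n * p)) (f : Eu n → ℝ)
    (hf : Integrable f) (hf1 : ∀ x, |f x| ≤ 1)
    (hanti : AntitoneOn (fun r : ℝ => ∫ θ, (∫ ξ, f ξ * ‖r • θ - ξ‖ ^ (2 * (p - 1))) ∂μ) (Ioi 0)) :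
    -(4 * p * (p - 1) + 2 * n * p) * (1 / (2 * n * (n + 2))) *
      (∫ x in ball (0 : Eu n) 1, ∫ ξ, f ξ * ‖x - ξ‖ ^ (2 * (p - 1))) ≤
      ∫ x in ball (0 : Eu n) 1, ∫ ξ, f ξ * ‖x - ξ‖ ^ (2 * p) := by
  have hn1 : 1 ≤ n := by omega
  set κ : ℝ := -(4 * p * (p - 1) + 2 * n * p) with hκd
  have hpos := phi_nonneg hn1 hμ hL (2 * (p - 1)) hp0 (by linarith) f hf hf1 hanti
  set φ : ℝ → ℝ := fun r : ℝ => ∫ θ, (∫ ξ, f ξ * ‖r • θ - ξ‖ ^ (2 * (p - 1))) ∂μ with hφ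
  have hFm : Measurable ((Iio (1 : ℝ)).indicator (1 : ℝ → ℝ)) := measurable_one.indicator measurableSet_Iio
  have hF0 : ∀ t, 0 ≤ (Iio (1 : ℝ)).indicator (1 : ℝ → ℝ) t :=
    fun t => indicator_nonneg (fun _ _ => by simp) _
  have ball_eq : ∀ g : Eu n → ℝ, ∫ x in ball (0 : Eu n) 1, g x =
      ∫ x, (Iio (1 : ℝ)).indicator (1 : ℝ → ℝ) ‖x‖ * g x := by
    intro g
    rw [← integral_indicator measurableSet_ball]
    congr 1; ext x
    rw [ind_norm]
    by_cases h : x ∈ ball (0 : Eu n) 1 <;> simp [indicator, h]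
  have Pa := pot_avg hn1 hμ hL (2 * (p - 1)) hp0 (by linarith) f hf hf1 _ hFm hF0 (ind_int 1)
  have Pb := pot_avg hn1 hμ hL (2 * p) (by linarith) (by linarith) f hf hf1 _ hFm hF0 (ind_int 1)
  rw [ball_eq, ball_eq, Pa.1, Pb.2.1]
  simp_rw [← ball_eq (fun x => ‖x - _‖ ^ (2 * p))]
  refine ge_of_tendsto (outer_lim hn1 (2 * p) (by linarith) (by linarith) f hf) ?_
  filter_upwards [Filter.eventually_ge_atTop (3 * n)] with m hm
  obtain ⟨k, k1, k2, d0, d1, c2, z0, z1, z2, hlap, hk0, hkc⟩ := cut_fn n hn m hm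
  have hm0 : (0 : ℝ) < m := by exact_mod_cast (by omega : 0 < m)
  have hz : ∀ x : Eu n, (m : ℝ) < ‖x‖ → (m : ℝ) ^ 2 ≤ ‖x‖ ^ 2 := fun x hx => by gcongr
  have ck : Continuous k := continuous_iff_continuousAt.2 fun s => (d0 s).continuousAt
  have ckx : Continuous (fun r : ℝ => k (r ^ 2)) := ck.comp (continuous_pow 2)
  have hFi : Integrable (fun x : Eu n => k (‖x‖ ^ 2)) :=
    (ckx.comp continuous_norm).integrable_of_hasCompactSupport
      (HasCompactSupport.intro (isCompact_closedBall (0 : Eu n) m) fun x hx =>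
        z0 _ (hz x (by simpa using hx)))
  have Pc := pot_avg hn1 hμ hL (2 * (p - 1)) hp0 (by linarith) f hf hf1 (fun r => k (r ^ 2))
    ckx.measurable (fun r => hk0 _ (by positivity)) hFi
  have hR : ∀ ξ : Eu n, κ * ∫ x, k (‖x‖ ^ 2) * ‖x - ξ‖ ^ (2 * (p - 1)) =
      (∫ x : Eu n, etaF m (‖x‖ ^ 2 / 1 ^ 2) * ‖x - ξ‖ ^ (2 * p)) -
      ((m : ℝ) ^ n)⁻¹ * ∫ x : Eu n, etaF m (‖x‖ ^ 2 / (m : ℝ) ^ 2) * ‖x - ξ‖ ^ (2 * p) := by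
    intro ξ
    have e := riesz_id hn1 p hp0 hp.le k k1 k2 m (fun s _ => d0 s) (fun s _ => d1 s) c2.continuousOn
      (fun x hx => z0 _ (hz x hx)) (fun x hx => z1 _ (hz x hx)) (fun x hx => z2 _ (hz x hx)) ξ
    have E1 := (eta_ker hn1 (2 * p) (by linarith) (by linarith) m 1 one_pos ξ).1
    have E2 := (eta_ker hn1 (2 * p) (by linarith) (by linarith) m m hm0 ξ).1
    rw [hκd, neg_mul, e, ← integral_const_mul, ← integral_sub E1 (E2.const_mul _), ← integral_neg]
    congr 1; ext x
    rw [hlap _ (by positivity), one_pow, div_one]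
    ring
  have hval : κ * ∫ x : Eu n, k (‖x‖ ^ 2) * φ ‖x‖ = ∫ ξ : Eu n, f ξ *
      ((∫ x : Eu n, etaF m (‖x‖ ^ 2 / 1 ^ 2) * ‖x - ξ‖ ^ (2 * p)) -
      ((m : ℝ) ^ n)⁻¹ * ∫ x : Eu n, etaF m (‖x‖ ^ 2 / (m : ℝ) ^ 2) * ‖x - ξ‖ ^ (2 * p)) := by
    rw [show ∫ x : Eu n, k (‖x‖ ^ 2) * φ ‖x‖ = ∫ ξ, f ξ * ∫ x, k (‖x‖ ^ 2) * ‖x - ξ‖ ^ (2 * (p - 1)) from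
      Pc.1.symm.trans Pc.2.1, ← integral_const_mul]
    congr 1; ext ξ
    rw [← hR ξ]; ring
  rw [← hval, mul_assoc]
  refine mul_le_mul_of_nonneg_left ?_ hκ
  rw [← integral_const_mul]
  have hNe : ∀ᵐ x : Eu n, x ≠ 0 := by
    have : Nonempty (Fin n) := ⟨⟨0, hn1⟩⟩
    simp [ae_iff]
  refine integral_mono_ae (Pa.2.2.const_mul _) Pc.2.2 ?_
  filter_upwards [hNe] with x hx
  have h3 : 0 ≤ φ ‖x‖ := hpos _ (norm_pos_iff.2 hx)
  change 1 / (2 * (n : ℝ) * (n + 2)) * ((Iio (1 : ℝ)).indicator (1 : ℝ → ℝ) ‖x‖ * φ ‖x‖) ≤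
    k (‖x‖ ^ 2) * φ ‖x‖
  rw [← mul_assoc]
  refine mul_le_mul_of_nonneg_right ?_ h3
  by_cases h : ‖x‖ < 1
  · rw [indicator_of_mem (show ‖x‖ ∈ Iio (1 : ℝ) from h), Pi.one_apply, mul_one]
    exact hkc _ (by positivity) (pow_le_one₀ (norm_nonneg _) h.le)
  · rw [indicator_of_notMem (show ‖x‖ ∉ Iio (1 : ℝ) from h), mul_zero]
    exact hk0 _ (by positivity)

lemma rieszConst_pos (n : ℕ) (α : ℝ) (h0 : 0 < α) (h1 : α < n) : 0 < rieszConst n α := by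
  unfold rieszConst
  have := Real.Gamma_pos_of_pos (show 0 < α / 2 by linarith)
  have := Real.Gamma_pos_of_pos (show 0 < ((n : ℝ) - α) / 2 by linarith)
  have := Real.pi_pos
  positivity

lemma rieszConst_rec (n : ℕ) (α : ℝ) (h0 : 0 < α) (h1 : α + 2 < n) :
    rieszConst n α = α * (n - α - 2) * rieszConst n (α + 2) := by
  unfold rieszConst
  have g1 := Real.Gamma_pos_of_pos (show 0 < α / 2 by linarith)
  have g2 := Real.Gamma_pos_of_pos (show 0 < ((n : ℝ) - (α + 2)) / 2 by linarith)
  have hpi := Real.pi_pos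
  rw [show (α + 2) / 2 = α / 2 + 1 by ring, Real.Gamma_add_one (by linarith),
    show ((n : ℝ) - α) / 2 = ((n : ℝ) - (α + 2)) / 2 + 1 by ring, Real.Gamma_add_one (by linarith),
    Real.rpow_add two_pos, Real.rpow_two]
  have h2 : (0 : ℝ) < 2 ^ α := by positivity
  have h3 : (0 : ℝ) < Real.pi ^ ((n : ℝ) / 2) := by positivity
  generalize Real.Gamma (α / 2) = a at *
  generalize Real.Gamma (((n : ℝ) - (α + 2)) / 2) = b at *
  generalize (2 : ℝ) ^ α = c at *
  generalize Real.pi ^ ((n : ℝ) / 2) = d at *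
  field_simp
  ring

/-- If the spherical averages of `I_α f_E` are nonincreasing, then the mean of
`I_α f_E` over `B_1` is controlled by that of `I_{α+2} f_E`. -/
theorem statement10 (n : ℕ) (hn : 5 ≤ n) (α : ℝ) (hα : α ∈ Set.Icc 2 ((n : ℝ) - 3))
    (E : Set (EuclideanSpace ℝ (Fin n))) (hE : HasFinitePerimeter E)
    (hvol : volume E = volume (ball (0 : EuclideanSpace ℝ (Fin n)) 1))
    (hmono : AntitoneOn (sphAvg (rieszPot α (fE E))) (Set.Ioi 0)) :
    ballAvg (rieszPot α (fE E)) 1 ≤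
      2 * (n : ℝ) * ((n : ℝ) + 2) * ballAvg (rieszPot (α + 2) (fE E)) 1 := by
  obtain ⟨hα2, hα3⟩ := hα
  have hN : (5 : ℝ) ≤ n := by exact_mod_cast hn
  have hn1 : 1 ≤ n := by omega
  obtain ⟨μ, hμp, hμ1, hμL, hμs⟩ := exists_sphMeasure n hn1
  have hf : Integrable (fE E) := by
    unfold fE
    refine Integrable.sub ?_ ?_
    · exact (integrable_indicator_iff measurableSet_ball).2 (integrableOn_const measure_ball_lt_top.ne)
    · exact (integrable_indicator_iff hE.1).2
        (integrableOn_const (by rw [hvol]; exact measure_ball_lt_top.ne))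
  have hf1 : ∀ x, |fE E x| ≤ 1 := by
    intro x
    unfold fE
    by_cases h : x ∈ ball (0 : Eu n) 1 <;> by_cases h' : x ∈ E <;>
      simp only [indicator, h, h', if_true, if_false, Pi.one_apply] <;> norm_num
  have hσ := rieszConst_pos n α (by linarith) (by linarith)
  have hσ2 := rieszConst_pos n (α + 2) (by linarith) (by linarith)
  have hrec := rieszConst_rec n α (by linarith) (by linarith)
  set p : ℝ := (α + 2 - n) / 2 with hp
  have e1 : 2 * (p - 1) = α - n := by rw [hp]; ring
  have e2 : 2 * p = α + 2 - n := by rw [hp]; ring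
  have e3 : -(4 * p * (p - 1) + 2 * n * p) = α * (n - α - 2) := by rw [hp]; ring
  have hanti : AntitoneOn (fun r : ℝ => ∫ θ, (∫ ξ, fE E ξ * ‖r • θ - ξ‖ ^ (2 * (p - 1))) ∂μ) (Ioi 0) := by
    intro r hr s hs hrs
    have h := hmono hr hs hrs
    rw [hμs _ _ hr, hμs _ _ hs] at h
    simp only [rieszPot] at h
    rw [integral_const_mul, integral_const_mul] at h
    simp only [e1]
    exact le_of_mul_le_mul_left h hσ
  have key := main_ineq hn hμ1 hμL p (by rw [e1]; linarith) (by rw [hp]; linarith)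
    (by rw [e3]; exact mul_nonneg (by linarith) (by linarith)) (fE E) hf hf1 hanti
  rw [e1, e2, e3] at key
  unfold ballAvg
  simp only [rieszPot]
  rw [integral_const_mul, integral_const_mul, hrec]
  set V := (volume (ball (0 : Eu n) 1)).toReal⁻¹ with hV
  have hV0 : 0 ≤ V := by rw [hV]; positivity
  set A := ∫ x in ball (0 : Eu n) 1, ∫ ξ, fE E ξ * ‖x - ξ‖ ^ (α - n) with hA
  set B := ∫ x in ball (0 : Eu n) 1, ∫ ξ, fE E ξ * ‖x - ξ‖ ^ (α + 2 - n) with hB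
  set σ := rieszConst n (α + 2) with hσd
  have hc : 0 ≤ 2 * (n : ℝ) * (n + 2) * V * σ := by positivity
  have := mul_le_mul_of_nonneg_left key hc
  calc V * (α * (n - α - 2) * σ * A) =
        2 * (n : ℝ) * (n + 2) * V * σ * (α * (n - α - 2) * (1 / (2 * n * (n + 2))) * A) := by
        field_simp
    _ ≤ _ := this
    _ = _ := by ring
end

section
/- Let n ≥ 5, let α ∈ [2, n−3], and let E ⊂ ℝⁿ be a set of finite perimeter with |E| = |B_1|. Set f_E = χ_{B_1} − χ_E and φ_α(r) = (1/H^{n−1}(∂B_r)) ∫_{∂B_r} I_α f_E dH^{n−1}. If φ_α is nonincreasing on (0,∞), then (1/|B_1|) ∫_{B_1} I_α f_E(x) dx ≤ 2n · I_{α+2} f_E(0). -/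
open MeasureTheory Metric Set

open scoped NNReal ENNReal

lemma aux_haus_pos (m : ℕ) :
    0 < μH[(m : ℝ)] (sphere (0 : EuclideanSpace ℝ (Fin (m+1))) 1) := by
  let P : EuclideanSpace ℝ (Fin (m+1)) → (Fin m → ℝ) := fun x j => x j.succ
  have hP : LipschitzWith 1 P := by
    refine LipschitzWith.of_dist_le_mul fun x y => ?_
    simp only [NNReal.coe_one, one_mul]
    refine (dist_pi_le_iff dist_nonneg).2 fun j => ?_
    have := PiLp.dist_apply_le (p := 2) x y j.succ
    simpa using this
  have h1 := hP.hausdorffMeasure_image_le (d := (m : ℝ)) (by positivity)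
    (sphere (0 : EuclideanSpace ℝ (Fin (m+1))) 1)
  have h2 : {y : Fin m → ℝ | ∑ j, y j ^ 2 < 1} ⊆ P '' (sphere (0 : EuclideanSpace ℝ (Fin (m+1))) 1) := by
    intro y hy
    simp only [mem_ofPred_eq] at hy
    refine ⟨WithLp.toLp 2 (Fin.cons (Real.sqrt (1 - ∑ j, y j ^ 2)) y : Fin (m+1) → ℝ), ?_, ?_⟩
    · simp only [mem_sphere_iff_norm, sub_zero, EuclideanSpace.norm_eq, Fin.sum_univ_succ]
      simp only [Real.norm_eq_abs, sq_abs, Fin.cons_zero, Fin.cons_succ]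
      rw [Real.sq_sqrt (by linarith)]
      simp
    · ext j; simp [P]
  have h3 : 0 < volume {y : Fin m → ℝ | ∑ j, y j ^ 2 < 1} := by
    apply IsOpen.measure_pos
    · exact isOpen_lt (by fun_prop) continuous_const
    · exact ⟨0, by simp⟩
  have h4 : (μH[(m : ℝ)] : Measure (Fin m → ℝ)) = volume := by
    have := hausdorffMeasure_pi_real (ι := Fin m)
    simpa using this
  rw [h4] at h1
  simp at h1
  exact h3.trans_le ((measure_mono h2).trans h1)

lemma aux_haus_fin (m : ℕ) :
    μH[(m : ℝ)] (sphere (0 : EuclideanSpace ℝ (Fin (m+1))) 1) < ∞ := by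
  have h4 : (μH[(m : ℝ)] : Measure (Fin m → ℝ)) = volume := by
    have := hausdorffMeasure_pi_real (ι := Fin m)
    simpa using this
  let J : Fin (m+1) → ℝ → (Fin m → ℝ) → EuclideanSpace ℝ (Fin (m+1)) :=
    fun i s y => WithLp.toLp 2 (i.insertNth s y : Fin (m+1) → ℝ)
  let N : EuclideanSpace ℝ (Fin (m+1)) → EuclideanSpace ℝ (Fin (m+1)) := fun x => ‖x‖⁻¹ • x
  have hJ : ∀ i s, ∃ C, LipschitzWith C (J i s) := by
    intro i s
    have : LipschitzWith 1 (fun y : Fin m → ℝ => (i.insertNth s y : Fin (m+1) → ℝ)) := by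
      refine LipschitzWith.of_dist_le_mul fun x y => ?_
      simp only [NNReal.coe_one, one_mul]
      refine (dist_pi_le_iff dist_nonneg).2 fun j => ?_
      refine Fin.succAboveCases i ?_ (fun k => ?_) j
      · simp
      · simpa using dist_le_pi_dist x y k
    exact ⟨_, (PiLp.lipschitzWith_toLp 2 (fun _ : Fin (m+1) => ℝ)).comp this⟩
  have hN : LipschitzOnWith 2 N {x | 1 ≤ ‖x‖} := by
    refine LipschitzOnWith.of_dist_le_mul fun x hx y hy => ?_
    simp only [mem_ofPred_eq] at hx hy
    have e : N x - N y = ‖x‖⁻¹ • (x - y) + (‖x‖⁻¹ * (‖y‖ - ‖x‖)) • N y := by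
      simp only [N, smul_smul, smul_sub]
      have : ‖x‖⁻¹ * (‖y‖ - ‖x‖) * ‖y‖⁻¹ = ‖x‖⁻¹ - ‖y‖⁻¹ := by
        field_simp
      rw [this, sub_smul]; abel
    have hNy : ‖N y‖ = 1 := by
      simp only [N, norm_smul, norm_inv, norm_norm]; field_simp
    rw [dist_eq_norm, dist_eq_norm, e]
    have hx' : ‖x‖⁻¹ ≤ 1 := inv_le_one_of_one_le₀ hx
    have hx0 : 0 ≤ ‖x‖⁻¹ := by positivity
    calc _ ≤ ‖‖x‖⁻¹ • (x - y)‖ + ‖(‖x‖⁻¹ * (‖y‖ - ‖x‖)) • N y‖ := norm_add_le _ _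
      _ = ‖x‖⁻¹ * ‖x - y‖ + ‖x‖⁻¹ * |‖y‖ - ‖x‖| := by
        rw [norm_smul, norm_smul, hNy]; simp
      _ ≤ 1 * ‖x - y‖ + 1 * ‖x - y‖ := by
        gcongr
        rw [abs_sub_comm]; exact abs_norm_sub_norm_le x y
      _ = _ := by norm_num; ring
  let K : Set (Fin m → ℝ) := Icc (fun _ => -1) (fun _ => 1)
  have hK : volume K < ∞ := isCompact_Icc.measure_lt_top
  have hJ1 : ∀ i s, |s| = 1 → ∀ y, 1 ≤ ‖J i s y‖ := by
    intro i s hs y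
    have := PiLp.norm_apply_le (p := 2) (J i s y) i
    simpa [J, hs] using this
  have hcov : sphere (0 : EuclideanSpace ℝ (Fin (m+1))) 1 ⊆
      (⋃ i : Fin (m+1), (N ∘ J i 1) '' K) ∪ (⋃ i : Fin (m+1), (N ∘ J i (-1)) '' K) := by
    intro x hx
    have hx1 : ‖x‖ = 1 := by simpa using hx
    obtain ⟨i, -, hi⟩ := Finset.exists_max_image Finset.univ (fun j => |x j|) Finset.univ_nonempty
    have hne : 0 < |x i| := by
      rcases (abs_nonneg (x i)).eq_or_lt with h | h
      · exfalso
        have : x = 0 := by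
          ext j
          have := hi j (Finset.mem_univ _)
          rw [← h] at this
          simpa using this
        rw [this] at hx1; simp at hx1
      · exact h
    have key : ∃ s : ℝ, (s = 1 ∨ s = -1) ∧ x ∈ (N ∘ J i s) '' K := by
      refine ⟨|x i|⁻¹ * x i, ?_, fun j => |x i|⁻¹ * x (i.succAbove j), ?_, ?_⟩
      · rcases lt_or_gt_of_ne (abs_pos.1 hne) with h | h
        · right; rw [abs_of_neg h, inv_neg, neg_mul, inv_mul_cancel₀ h.ne]
        · left; rw [abs_of_pos h]; field_simp
      · have : ∀ j : Fin m, |(|x i|⁻¹ * x (i.succAbove j))| ≤ 1 := by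
          intro j
          rw [abs_mul, abs_inv, abs_abs, inv_mul_le_iff₀ hne, mul_one]
          exact hi _ (Finset.mem_univ _)
        exact ⟨fun j => (abs_le.1 (this j)).1, fun j => (abs_le.1 (this j)).2⟩
      · have : J i (|x i|⁻¹ * x i) (fun j => |x i|⁻¹ * x (i.succAbove j)) = |x i|⁻¹ • x := by
          ext j
          refine Fin.succAboveCases i ?_ (fun k => ?_) j <;> simp [J]
        simp only [Function.comp, this, N, norm_smul, hx1, smul_smul]
        simp only [norm_inv, Real.norm_eq_abs, abs_abs, mul_one, inv_inv]
        rw [mul_inv_cancel₀ hne.ne', one_smul]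
    obtain ⟨s, hs | hs, h⟩ := key
    · left; rw [mem_iUnion]; exact ⟨i, hs ▸ h⟩
    · right; rw [mem_iUnion]; exact ⟨i, hs ▸ h⟩
  have hfin : ∀ i s, |s| = 1 → μH[(m : ℝ)] ((N ∘ J i s) '' K) < ∞ := by
    intro i s hs
    obtain ⟨C, hC⟩ := hJ i s
    have hL : LipschitzOnWith (2 * C) (N ∘ J i s) K :=
      hN.comp hC.lipschitzOnWith (fun y _ => hJ1 i s hs y)
    refine (hL.hausdorffMeasure_image_le (d := (m : ℝ)) (by positivity)).trans_lt ?_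
    rw [h4]
    refine ENNReal.mul_lt_top ?_ hK
    exact ENNReal.rpow_lt_top_of_nonneg (by positivity) ENNReal.coe_ne_top
  refine (measure_mono hcov).trans_lt ((measure_union_le _ _).trans_lt (ENNReal.add_lt_top.2 ⟨?_, ?_⟩))
  · refine (measure_iUnion_fintype_le _ _).trans_lt (ENNReal.sum_lt_top.2 fun i _ => hfin i 1 (by simp))
  · refine (measure_iUnion_fintype_le _ _).trans_lt (ENNReal.sum_lt_top.2 fun i _ => hfin i (-1) (by simp))

noncomputable def auxHeat (n : ℕ) (τ ρ : ℝ) : ℝ :=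
  (4 * Real.pi * τ) ^ (-(n : ℝ) / 2) * Real.exp (-(ρ ^ 2 / (4 * τ)))

lemma auxHeat_nonneg (n : ℕ) {τ : ℝ} (hτ : 0 < τ) (ρ : ℝ) : 0 ≤ auxHeat n τ ρ := by
  unfold auxHeat; positivity

lemma aux_rieszConst_pos (n : ℕ) {β : ℝ} (hβ : 0 < β) (hβn : β < n) : 0 < rieszConst n β := by
  unfold rieszConst
  have h1 : 0 < Real.Gamma (β / 2) := Real.Gamma_pos_of_pos (by linarith)
  have h2 : 0 < Real.Gamma (((n : ℝ) - β) / 2) := Real.Gamma_pos_of_pos (by linarith)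
  positivity

lemma aux_heat_lconv (n : ℕ) {s t : ℝ} (hs : 0 < s) (ht : 0 < t) (ξ : EuclideanSpace ℝ (Fin n)) :
    ∫⁻ x : EuclideanSpace ℝ (Fin n),
      ENNReal.ofReal (auxHeat n s ‖x‖) * ENNReal.ofReal (auxHeat n t ‖x - ξ‖) =
      ENNReal.ofReal (auxHeat n (s + t) ‖ξ‖) := by
  set b : ℝ := (s + t) / (4 * s * t) with hb
  have hb0 : 0 < b := by positivity
  set c : ℝ := s / (s + t) with hc
  have hint := GaussianFourier.integral_rexp_neg_mul_sq_norm (V := EuclideanSpace ℝ (Fin n)) hb0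
  rw [← integral_sub_right_eq_self _ (c • ξ)] at hint
  have hI : Integrable (fun x : EuclideanSpace ℝ (Fin n) => Real.exp (-b * ‖x - c • ξ‖ ^ 2)) := by
    refine Integrable.of_integral_ne_zero ?_
    rw [hint]; positivity
  set A : ℝ := (4 * Real.pi * s) ^ (-(n : ℝ) / 2) * (4 * Real.pi * t) ^ (-(n : ℝ) / 2) *
    Real.exp (-(‖ξ‖ ^ 2 / (4 * (s + t)))) with hA
  have hA0 : 0 ≤ A := by positivity
  have e : ∀ x : EuclideanSpace ℝ (Fin n),
      ENNReal.ofReal (auxHeat n s ‖x‖) * ENNReal.ofReal (auxHeat n t ‖x - ξ‖) =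
      ENNReal.ofReal (A * Real.exp (-b * ‖x - c • ξ‖ ^ 2)) := by
    intro x
    rw [← ENNReal.ofReal_mul (auxHeat_nonneg n hs _)]
    congr 1
    have hexp : Real.exp (-(‖x‖ ^ 2 / (4 * s))) * Real.exp (-(‖x - ξ‖ ^ 2 / (4 * t))) =
        Real.exp (-(‖ξ‖ ^ 2 / (4 * (s + t)))) * Real.exp (-b * ‖x - c • ξ‖ ^ 2) := by
      rw [← Real.exp_add, ← Real.exp_add]
      congr 1
      rw [norm_sub_sq_real, norm_sub_sq_real, inner_smul_right, norm_smul, mul_pow, Real.norm_eq_abs,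
        sq_abs, hb, hc]
      field_simp
      ring
    unfold auxHeat
    rw [hA]
    linear_combination ((4 * Real.pi * s) ^ (-(n : ℝ) / 2) * (4 * Real.pi * t) ^ (-(n : ℝ) / 2)) * hexp
  simp_rw [e]
  rw [← ofReal_integral_eq_lintegral_ofReal (hI.const_mul A)
    (Filter.Eventually.of_forall fun x => by positivity)]
  congr 1
  rw [integral_const_mul, hint, hA]
  unfold auxHeat
  have : (4 * Real.pi * s) ^ (-(n : ℝ) / 2) * (4 * Real.pi * t) ^ (-(n : ℝ) / 2) *
      (Real.pi / b) ^ ((n : ℝ) / 2) = (4 * Real.pi * (s + t)) ^ (-(n : ℝ) / 2) := by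
    rw [show (Real.pi / b) ^ ((n : ℝ) / 2) = (b / Real.pi) ^ (-(n : ℝ) / 2) by
      rw [neg_div, Real.rpow_neg (by positivity), ← Real.inv_rpow (by positivity), inv_div]]
    rw [← Real.mul_rpow (by positivity) (by positivity), ← Real.mul_rpow (by positivity) (by positivity)]
    congr 1
    rw [hb]; field_simp
  simp only [finrank_euclideanSpace, Fintype.card_fin]
  linear_combination Real.exp (-(‖ξ‖ ^ 2 / (4 * (s + t)))) * this

lemma aux_heat_lint (n : ℕ) {β ρ : ℝ} (hβ : 0 < β) (hβn : β < n) (hρ : 0 < ρ) :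
    ∫⁻ τ in Ioi (0:ℝ), ENNReal.ofReal (τ ^ (β / 2 - 1) * auxHeat n τ ρ) =
      ENNReal.ofReal (Real.Gamma (β / 2) * rieszConst n β * ρ ^ (β - n)) := by
  set a : ℝ := ((n : ℝ) - β) / 2 with ha
  have ha0 : 0 < a := by rw [ha]; linarith
  have hr0 : 0 < ρ ^ 2 / 4 := by positivity
  have hG1 : 0 < Real.Gamma (β / 2) := Real.Gamma_pos_of_pos (by linarith)
  have hG2 : 0 < Real.Gamma a := Real.Gamma_pos_of_pos ha0
  have h1 := Real.integral_rpow_mul_exp_neg_mul_Ioi ha0 hr0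
  rw [← integral_comp_rpow_Ioi _ (show (-1 : ℝ) ≠ 0 by norm_num)] at h1
  have h2 : ∫ τ in Ioi (0:ℝ), τ ^ (β / 2 - 1) * auxHeat n τ ρ =
      (4 * Real.pi) ^ (-(n : ℝ) / 2) * ((1 / (ρ ^ 2 / 4)) ^ a * Real.Gamma a) := by
    rw [← h1, ← integral_const_mul]
    refine setIntegral_congr_fun measurableSet_Ioi fun τ (hτ : 0 < τ) => ?_
    simp only [auxHeat, smul_eq_mul, abs_neg, abs_one, one_mul, Real.rpow_neg_one]
    rw [Real.mul_rpow (by positivity) hτ.le, Real.inv_rpow hτ.le, ← Real.rpow_neg hτ.le]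
    have e1 : τ ^ (β / 2 - 1) * τ ^ (-(n : ℝ) / 2) = τ ^ ((-1:ℝ) - 1) * τ ^ (-(a - 1)) := by
      rw [← Real.rpow_add hτ, ← Real.rpow_add hτ]; congr 1; rw [ha]; ring
    have e2 : ρ ^ 2 / (4 * τ) = ρ ^ 2 / 4 * τ⁻¹ := by field_simp
    rw [e2]
    linear_combination (4 * Real.pi) ^ (-(n : ℝ) / 2) * Real.exp (-(ρ ^ 2 / 4 * τ⁻¹)) * e1
  have hpos : 0 < (4 * Real.pi) ^ (-(n : ℝ) / 2) * ((1 / (ρ ^ 2 / 4)) ^ a * Real.Gamma a) := by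
    positivity
  rw [← ofReal_integral_eq_lintegral_ofReal]
  · rw [h2]
    congr 1
    unfold rieszConst
    rw [← ha]
    have e1 : (4 * Real.pi) ^ (-(n : ℝ) / 2) = (2 : ℝ) ^ (-(n : ℝ)) * (Real.pi ^ ((n : ℝ) / 2))⁻¹ := by
      rw [Real.mul_rpow (by norm_num) Real.pi_pos.le, ← Real.rpow_neg Real.pi_pos.le,
        show (4 : ℝ) = 2 ^ (2 : ℝ) by norm_num, ← Real.rpow_mul (by norm_num)]
      congr 2 <;> ring
    have e2 : (1 / (ρ ^ 2 / 4)) ^ a = (2 : ℝ) ^ ((n : ℝ) - β) * ρ ^ (β - n) := by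
      rw [show 1 / (ρ ^ 2 / 4) = (2 : ℝ) ^ (2 : ℝ) * ρ ^ (-2 : ℝ) by
        rw [Real.rpow_neg hρ.le]; norm_num; field_simp]
      rw [Real.mul_rpow (by positivity) (by positivity), ← Real.rpow_mul (by norm_num),
        ← Real.rpow_mul hρ.le]
      congr 2 <;> rw [ha] <;> ring
    have e3 : (2 : ℝ) ^ (-(n : ℝ)) * (2 : ℝ) ^ ((n : ℝ) - β) = (2 ^ β)⁻¹ := by
      rw [← Real.rpow_add (by norm_num), ← Real.rpow_neg (by norm_num)]; congr 1; ring
    rw [e1, e2]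
    calc _ = ((2 : ℝ) ^ (-(n : ℝ)) * (2 : ℝ) ^ ((n : ℝ) - β)) * (Real.pi ^ ((n : ℝ) / 2))⁻¹ *
          ρ ^ (β - n) * Real.Gamma a := by ring
      _ = _ := by rw [e3]; field_simp
  · exact Integrable.of_integral_ne_zero (by rw [h2]; exact hpos.ne')
  · filter_upwards [self_mem_ae_restrict measurableSet_Ioi] with τ hτ
    exact mul_nonneg (Real.rpow_nonneg (le_of_lt hτ) _) (auxHeat_nonneg n hτ _)

lemma aux_semigroup (n : ℕ) (hn : 2 < n) {α : ℝ} (hα : 0 < α) (hαn : α + 2 < n)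
    (ξ : EuclideanSpace ℝ (Fin n)) (hξ : ξ ≠ 0) :
    ENNReal.ofReal (rieszConst n 2 * rieszConst n α) *
    ∫⁻ x : EuclideanSpace ℝ (Fin n),
      ENNReal.ofReal (‖x‖ ^ (2 - (n : ℝ))) * ENNReal.ofReal (‖x - ξ‖ ^ (α - n)) =
      ENNReal.ofReal (rieszConst n (α + 2) * ‖ξ‖ ^ (α + 2 - n)) := by
  have : Nonempty (Fin n) := ⟨⟨0, by omega⟩⟩
  have hn2 : (2 : ℝ) < n := by exact_mod_cast hn
  have hG : 0 < Real.Gamma (α / 2) := Real.Gamma_pos_of_pos (by linarith)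
  have hc2 := aux_rieszConst_pos n (β := 2) (by norm_num) hn2
  have hca := aux_rieszConst_pos n (β := α) hα (by linarith)
  have hca2 := aux_rieszConst_pos n (β := α + 2) (by linarith) (by linarith)
  have hmeas : Measurable (fun p : ℝ × EuclideanSpace ℝ (Fin n) => auxHeat n p.1 ‖p.2‖) := by
    unfold auxHeat; fun_prop
  have hm2 : Measurable (fun u => auxHeat n u ‖ξ‖) := by unfold auxHeat; fun_prop
  have key : ENNReal.ofReal (Real.Gamma (α / 2)) * (ENNReal.ofReal (rieszConst n 2 * rieszConst n α) *
    ∫⁻ x : EuclideanSpace ℝ (Fin n),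
      ENNReal.ofReal (‖x‖ ^ (2 - (n : ℝ))) * ENNReal.ofReal (‖x - ξ‖ ^ (α - n))) =
      ENNReal.ofReal (Real.Gamma (α / 2)) * ENNReal.ofReal (rieszConst n (α + 2) * ‖ξ‖ ^ (α + 2 - n)) := by
    calc _ = ∫⁻ x : EuclideanSpace ℝ (Fin n),
          ENNReal.ofReal (Real.Gamma ((2:ℝ) / 2) * rieszConst n 2 * ‖x‖ ^ (2 - (n : ℝ))) *
          ENNReal.ofReal (Real.Gamma (α / 2) * rieszConst n α * ‖x - ξ‖ ^ (α - n)) := by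
          rw [← mul_assoc, ← lintegral_const_mul _ (by fun_prop)]
          refine lintegral_congr fun x => ?_
          rw [← ENNReal.ofReal_mul (by positivity), ← ENNReal.ofReal_mul (by positivity),
            ← ENNReal.ofReal_mul (by positivity), ← ENNReal.ofReal_mul (by norm_num; positivity)]
          norm_num
          congr 1; ring
      _ = ∫⁻ x : EuclideanSpace ℝ (Fin n),
          (∫⁻ s in Ioi (0:ℝ), ENNReal.ofReal (auxHeat n s ‖x‖)) *
          (∫⁻ t in Ioi (0:ℝ), ENNReal.ofReal (t ^ (α / 2 - 1) * auxHeat n t ‖x - ξ‖)) := by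
          refine lintegral_congr_ae ?_
          filter_upwards [compl_mem_ae_iff.2 (measure_singleton (0 : EuclideanSpace ℝ (Fin n))),
            compl_mem_ae_iff.2 (measure_singleton ξ)] with x hx0 hxξ
          rw [← aux_heat_lint n (by norm_num) hn2 (norm_pos_iff.2 hx0),
            ← aux_heat_lint n hα (by linarith) (norm_pos_iff.2 (sub_ne_zero.2 hxξ))]
          norm_num
      _ = ∫⁻ x : EuclideanSpace ℝ (Fin n), ∫⁻ s in Ioi (0:ℝ), ∫⁻ t in Ioi (0:ℝ),
            ENNReal.ofReal (auxHeat n s ‖x‖) * 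
              ENNReal.ofReal (t ^ (α / 2 - 1) * auxHeat n t ‖x - ξ‖) := by
          refine lintegral_congr fun x => ?_
          rw [← lintegral_mul_const _ (by unfold auxHeat; fun_prop)]
          refine lintegral_congr fun s => ?_
          rw [← lintegral_const_mul _ (by unfold auxHeat; fun_prop)]
      _ = ∫⁻ s in Ioi (0:ℝ), ∫⁻ t in Ioi (0:ℝ), ∫⁻ x : EuclideanSpace ℝ (Fin n), 
            ENNReal.ofReal (auxHeat n s ‖x‖) * 
              ENNReal.ofReal (t ^ (α / 2 - 1) * auxHeat n t ‖x - ξ‖) := by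
          rw [lintegral_lintegral_swap]
          · refine lintegral_congr fun s => ?_
            rw [lintegral_lintegral_swap]
            refine Measurable.aemeasurable ?_
            unfold auxHeat Function.uncurry; fun_prop
          · refine Measurable.aemeasurable ?_
            refine Measurable.lintegral_prod_right' (f := fun q : (EuclideanSpace ℝ (Fin n) × ℝ) × ℝ =>
              ENNReal.ofReal (auxHeat n q.1.2 ‖q.1.1‖) * 
              ENNReal.ofReal (q.2 ^ (α / 2 - 1) * auxHeat n q.2 ‖q.1.1 - ξ‖)) ?_
            unfold auxHeat; fun_prop
      _ = ∫⁻ s in Ioi (0:ℝ), ∫⁻ t in Ioi (0:ℝ), 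
            ENNReal.ofReal (t ^ (α / 2 - 1)) * ENNReal.ofReal (auxHeat n (s + t) ‖ξ‖) := by
          refine setLIntegral_congr_fun measurableSet_Ioi fun s hs => ?_
          refine setLIntegral_congr_fun measurableSet_Ioi fun t (ht : 0 < t) => ?_
          rw [← aux_heat_lconv n hs ht, ← lintegral_const_mul _ (by unfold auxHeat; fun_prop)]
          refine lintegral_congr fun x => ?_
          rw [ENNReal.ofReal_mul (by positivity)]
          ring
      _ = ∫⁻ t in Ioi (0:ℝ), ∫⁻ s in Ioi (0:ℝ), 
            ENNReal.ofReal (t ^ (α / 2 - 1)) * ENNReal.ofReal (auxHeat n (s + t) ‖ξ‖) := by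
          rw [lintegral_lintegral_swap]
          refine Measurable.aemeasurable ?_
          unfold auxHeat Function.uncurry; fun_prop
      _ = ∫⁻ t in Ioi (0:ℝ), ∫⁻ u in Ioi (0:ℝ), 
            (Ioi t).indicator (fun u => ENNReal.ofReal (t ^ (α / 2 - 1)) * ENNReal.ofReal (auxHeat n u ‖ξ‖)) u := by
          refine setLIntegral_congr_fun measurableSet_Ioi fun t (ht : 0 < t) => ?_
          rw [← lintegral_indicator measurableSet_Ioi, ← lintegral_indicator measurableSet_Ioi,
            ← lintegral_sub_right_eq_self _ t]
          refine lintegral_congr fun u => ?_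
          by_cases h : t < u
          · have : 0 < u := ht.trans h
            simp [indicator, h, this]
          · simp [indicator, h]
      _ = ∫⁻ u in Ioi (0:ℝ), ∫⁻ t in Ioi (0:ℝ),
            (Ioi t).indicator (fun u => ENNReal.ofReal (t ^ (α / 2 - 1)) * ENNReal.ofReal (auxHeat n u ‖ξ‖)) u := by
          rw [lintegral_lintegral_swap]
          refine Measurable.aemeasurable ?_
          have : MeasurableSet {p : ℝ × ℝ | p.1 < p.2} := measurableSet_lt measurable_fst measurable_snd
          have h2 : Measurable (fun p : ℝ × ℝ => ENNReal.ofReal (p.1 ^ (α / 2 - 1)) * ENNReal.ofReal (auxHeat n p.2 ‖ξ‖)) := by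
            unfold auxHeat; fun_prop
          exact h2.indicator this
      _ = ∫⁻ u in Ioi (0:ℝ), ENNReal.ofReal (2 / α) * ENNReal.ofReal (u ^ ((α + 2) / 2 - 1) * auxHeat n u ‖ξ‖) := by
          refine setLIntegral_congr_fun measurableSet_Ioi fun u (hu : 0 < u) => ?_
          have e1 : ∀ t, (Ioi t).indicator (fun u => ENNReal.ofReal (t ^ (α / 2 - 1)) * ENNReal.ofReal (auxHeat n u ‖ξ‖)) u
              = (Iio u).indicator (fun t => ENNReal.ofReal (t ^ (α / 2 - 1)) * ENNReal.ofReal (auxHeat n u ‖ξ‖)) t := by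
            intro t; simp [indicator]
          simp_rw [e1]
          rw [lintegral_indicator measurableSet_Iio, Measure.restrict_restrict measurableSet_Iio,
            Iio_inter_Ioi, lintegral_mul_const _ (by fun_prop)]
          have hI : IntegrableOn (fun t : ℝ => t ^ (α / 2 - 1)) (Ioo 0 u) := by
            rw [← intervalIntegrable_iff_integrableOn_Ioo_of_le hu.le]
            exact intervalIntegral.intervalIntegrable_rpow' (by linarith)
          rw [← ofReal_integral_eq_lintegral_ofReal hI]
          · rw [← integral_Ioc_eq_integral_Ioo, ← intervalIntegral.integral_of_le hu.le,
              integral_rpow (Or.inl (by linarith))]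
            have hv : (u ^ (α / 2 - 1 + 1) - 0 ^ (α / 2 - 1 + 1)) / (α / 2 - 1 + 1) = 2 / α * u ^ (α / 2) := by
              rw [Real.zero_rpow (by linarith)]
              simp only [sub_add_cancel, sub_zero]
              field_simp
            rw [hv, ← ENNReal.ofReal_mul (by positivity), ← ENNReal.ofReal_mul (by positivity),
              show (α + 2) / 2 - 1 = α / 2 by ring]
            congr 1; ring
          · filter_upwards [self_mem_ae_restrict measurableSet_Ioo] with t ht
            exact Real.rpow_nonneg ht.1.le _
      _ = _ := by
          rw [lintegral_const_mul _ (by unfold auxHeat; fun_prop), aux_heat_lint n (by linarith) hαn (norm_pos_iff.2 hξ),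
            ← ENNReal.ofReal_mul (by positivity), ← ENNReal.ofReal_mul (by positivity)]
          congr 1
          rw [show (α + 2) / 2 = α / 2 + 1 by ring, Real.Gamma_add_one (by positivity)]
          field_simp
  refine (ENNReal.mul_right_inj ?_ ENNReal.ofReal_ne_top).1 key
  simpa using hG

noncomputable def auxNu (n : ℕ) : Measure (EuclideanSpace ℝ (Fin n)) :=
  (μH[(n : ℝ) - 1] (sphere (0 : EuclideanSpace ℝ (Fin n)) 1))⁻¹ •
    (μH[(n : ℝ) - 1]).restrict (sphere (0 : EuclideanSpace ℝ (Fin n)) 1)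

lemma aux_haus (n : ℕ) (hn : 1 ≤ n) :
    μH[(n : ℝ) - 1] (sphere (0 : EuclideanSpace ℝ (Fin n)) 1) ≠ 0 ∧
    μH[(n : ℝ) - 1] (sphere (0 : EuclideanSpace ℝ (Fin n)) 1) ≠ ∞ := by
  obtain ⟨m, rfl⟩ : ∃ m, n = m + 1 := ⟨n - 1, by omega⟩
  have : ((m + 1 : ℕ) : ℝ) - 1 = m := by push_cast; ring
  rw [this]
  exact ⟨(aux_haus_pos m).ne', (aux_haus_fin m).ne⟩

lemma auxNu_prob (n : ℕ) (hn : 1 ≤ n) : IsProbabilityMeasure (auxNu n) := by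
  constructor
  simp only [auxNu, Measure.smul_apply, Measure.restrict_apply MeasurableSet.univ, univ_inter,
    smul_eq_mul]
  exact ENNReal.inv_mul_cancel (aux_haus n hn).1 (aux_haus n hn).2

lemma auxNu_norm (n : ℕ) : ∀ᵐ ω ∂(auxNu n), ‖ω‖ = 1 := by
  unfold auxNu
  refine Measure.ae_smul_measure ?_ _
  filter_upwards [self_mem_ae_restrict isClosed_sphere.measurableSet] with ω hω
  simpa using hω

lemma auxNu_inv (n : ℕ) (L : EuclideanSpace ℝ (Fin n) ≃ₗᵢ[ℝ] EuclideanSpace ℝ (Fin n)) :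
    MeasurePreserving L (auxNu n) (auxNu n) := by
  unfold auxNu
  have h1 := L.toIsometryEquiv.measurePreserving_hausdorffMeasure ((n : ℝ) - 1)
  have h2 := h1.restrict_preimage
    (s := sphere (0 : EuclideanSpace ℝ (Fin n)) 1) isClosed_sphere.measurableSet
  have h3 : L.toIsometryEquiv ⁻¹' (sphere (0 : EuclideanSpace ℝ (Fin n)) 1) = sphere 0 1 := by
    ext x; simp
  rw [h3] at h2
  exact h2.smul_measure _

open scoped Pointwise in
lemma aux_sphAvg (n : ℕ) (hn : 1 ≤ n) (g : EuclideanSpace ℝ (Fin n) → ℝ) {r : ℝ} (hr : 0 < r) :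
    sphAvg g r = ∫ ω, g (r • ω) ∂(auxNu n) := by
  have hd : 0 ≤ (n : ℝ) - 1 := by
    have : (1 : ℝ) ≤ n := by exact_mod_cast hn
    linarith
  obtain ⟨h0, hT⟩ := aux_haus n hn
  set S := sphere (0 : EuclideanSpace ℝ (Fin n)) 1 with hS
  set μ : Measure (EuclideanSpace ℝ (Fin n)) := μH[(n : ℝ) - 1] with hμ
  have hrS : sphere (0 : EuclideanSpace ℝ (Fin n)) r = r • S := by
    rw [hS, smul_sphere' hr.ne']; simp [abs_of_pos hr]
  have hmapm : Measurable (fun x : EuclideanSpace ℝ (Fin n) => r • x) := by fun_prop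
  have hmap : μ.restrict (r • S) = (‖r‖₊ ^ ((n : ℝ) - 1)) • (μ.restrict S).map (fun x => r • x) := by
    ext s hs
    rw [Measure.smul_apply, Measure.map_apply hmapm hs, Measure.restrict_apply hs,
      Measure.restrict_apply (hmapm hs), hμ, ← Measure.hausdorffMeasure_smul₀ hd hr.ne',
      smul_set_inter₀ hr.ne']
    congr 2
    rw [preimage_smul₀ hr.ne', smul_inv_smul₀ hr.ne']
  have hc : (‖r‖₊ ^ ((n : ℝ) - 1) : ℝ≥0) ≠ 0 := by
    have : 0 < ‖r‖₊ := by simpa using hr.ne'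
    exact (NNReal.rpow_pos this).ne'
  unfold sphAvg auxNu
  rw [← hμ, ← hS, hrS, hmap, hμ, Measure.hausdorffMeasure_smul₀ hd hr.ne', ← hμ]
  have hemb : MeasurableEmbedding (fun x : EuclideanSpace ℝ (Fin n) => r • x) :=
    (Homeomorph.smulOfNeZero r hr.ne').measurableEmbedding
  rw [integral_smul_nnreal_measure, hemb.integral_map, integral_smul_measure]
  set c := (‖r‖₊ ^ ((n : ℝ) - 1) : ℝ≥0)
  have hc' : (c : ℝ) ≠ 0 := by exact_mod_cast hc
  simp only [ENNReal.smul_def, smul_eq_mul, ENNReal.toReal_mul, ENNReal.toReal_inv, NNReal.smul_def,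
    ENNReal.coe_toReal]
  field_simp

lemma aux_rot {n : ℕ} {x y : EuclideanSpace ℝ (Fin n)} (h : ‖x‖ = ‖y‖) :
    ∃ L : EuclideanSpace ℝ (Fin n) ≃ₗᵢ[ℝ] EuclideanSpace ℝ (Fin n), L x = y :=
  ⟨_, Submodule.reflection_sub h⟩

lemma aux_J_inv (n : ℕ) {K : ℝ → ℝ≥0∞} (a : ℝ) {x y : EuclideanSpace ℝ (Fin n)} (h : ‖x‖ = ‖y‖) :
    ∫⁻ ω, K ‖a • ω - x‖ ∂(auxNu n) = ∫⁻ ω, K ‖a • ω - y‖ ∂(auxNu n) := by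
  obtain ⟨L, rfl⟩ := aux_rot h
  rw [← (auxNu_inv n L).lintegral_comp_emb L.toHomeomorph.measurableEmbedding
    (fun ω => K ‖a • ω - L x‖)]
  refine lintegral_congr fun ω => ?_
  rw [← map_smul, ← map_sub, L.norm_map]

lemma aux_J_swap (n : ℕ) (hn : 1 ≤ n) {K : ℝ → ℝ≥0∞} (hK : Measurable K)
    (x ξ : EuclideanSpace ℝ (Fin n)) :
    ∫⁻ ω, K ‖‖x‖ • ω - ξ‖ ∂(auxNu n) = ∫⁻ ω, K ‖x - ‖ξ‖ • ω‖ ∂(auxNu n) := by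
  have := auxNu_prob n hn
  calc _ = ∫⁻ ω', ∫⁻ ω, K ‖‖x‖ • ω - ‖ξ‖ • ω'‖ ∂(auxNu n) ∂(auxNu n) := by
        have : ∀ᵐ ω' ∂(auxNu n), ∫⁻ ω, K ‖‖x‖ • ω - ‖ξ‖ • ω'‖ ∂(auxNu n) =
            ∫⁻ ω, K ‖‖x‖ • ω - ξ‖ ∂(auxNu n) := by
          filter_upwards [auxNu_norm n] with ω' hω'
          exact aux_J_inv n _ (by simp [norm_smul, hω'])
        rw [lintegral_congr_ae this]
        simp
    _ = ∫⁻ ω, ∫⁻ ω', K ‖‖x‖ • ω - ‖ξ‖ • ω'‖ ∂(auxNu n) ∂(auxNu n) := by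
        rw [lintegral_lintegral_swap]
        refine Measurable.aemeasurable ?_
        unfold Function.uncurry; fun_prop
    _ = ∫⁻ ω, ∫⁻ ω', K ‖x - ‖ξ‖ • ω'‖ ∂(auxNu n) ∂(auxNu n) := by
        refine lintegral_congr_ae ?_
        filter_upwards [auxNu_norm n] with ω hω
        simp_rw [norm_sub_rev _ (‖ξ‖ • _)]
        exact aux_J_inv n _ (by simp [norm_smul, hω])
    _ = _ := by simp

lemma aux_radial (n : ℕ) (hn : 1 ≤ n) {K w : ℝ → ℝ≥0∞} (hK : Measurable K) (hw : Measurable w)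
    {F : EuclideanSpace ℝ (Fin n) → ℝ≥0∞} (hF : Measurable F) :
    ∫⁻ x : EuclideanSpace ℝ (Fin n), w ‖x‖ * ∫⁻ ω, (∫⁻ ξ, F ξ * K ‖‖x‖ • ω - ξ‖) ∂(auxNu n) =
    ∫⁻ x : EuclideanSpace ℝ (Fin n), w ‖x‖ * ∫⁻ ξ, F ξ * K ‖x - ξ‖ := by
  have := auxNu_prob n hn
  calc _ = ∫⁻ x : EuclideanSpace ℝ (Fin n), ∫⁻ ξ : EuclideanSpace ℝ (Fin n), w ‖x‖ * (F ξ * ∫⁻ ω, K ‖‖x‖ • ω - ξ‖ ∂(auxNu n)) := by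
        refine lintegral_congr fun x => ?_
        rw [lintegral_lintegral_swap]
        · rw [← lintegral_const_mul]
          · refine lintegral_congr fun ξ => ?_
            rw [lintegral_const_mul]
            fun_prop
          · refine Measurable.lintegral_prod_right' (f := fun p : EuclideanSpace ℝ (Fin n) × EuclideanSpace ℝ (Fin n) => F p.1 * K ‖‖x‖ • p.2 - p.1‖) ?_
            fun_prop
        · refine Measurable.aemeasurable ?_
          unfold Function.uncurry; fun_prop
    _ = ∫⁻ x : EuclideanSpace ℝ (Fin n), ∫⁻ ξ : EuclideanSpace ℝ (Fin n), F ξ * ∫⁻ ω, w ‖x‖ * K ‖x - ‖ξ‖ • ω‖ ∂(auxNu n) := by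
        refine lintegral_congr fun x => lintegral_congr fun ξ => ?_
        rw [aux_J_swap n hn hK, lintegral_const_mul _ (by fun_prop)]
        ring
    _ = ∫⁻ ξ : EuclideanSpace ℝ (Fin n), ∫⁻ x : EuclideanSpace ℝ (Fin n), F ξ * ∫⁻ ω, w ‖x‖ * K ‖x - ‖ξ‖ • ω‖ ∂(auxNu n) := by
        rw [lintegral_lintegral_swap]
        refine Measurable.aemeasurable ?_
        refine Measurable.mul (by fun_prop) ?_
        refine Measurable.lintegral_prod_right' (f := fun p : (EuclideanSpace ℝ (Fin n) × EuclideanSpace ℝ (Fin n)) × EuclideanSpace ℝ (Fin n) => w ‖p.1.1‖ * K ‖p.1.1 - ‖p.1.2‖ • p.2‖) ?_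
        fun_prop
    _ = ∫⁻ ξ : EuclideanSpace ℝ (Fin n), F ξ * ∫⁻ x : EuclideanSpace ℝ (Fin n), w ‖x‖ * K ‖x - ξ‖ := by
        refine lintegral_congr fun ξ => ?_
        rw [lintegral_const_mul, lintegral_lintegral_swap]
        · congr 1
          calc _ = ∫⁻ ω, (∫⁻ x, w ‖x‖ * K ‖x - ξ‖) ∂(auxNu n) := by
                refine lintegral_congr_ae ?_
                filter_upwards [auxNu_norm n] with ω hω
                obtain ⟨L, hL⟩ := aux_rot (x := ξ) (y := ‖ξ‖ • ω) (by simp [norm_smul, hω])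
                rw [← hL, ← L.measurePreserving.lintegral_comp_emb L.toHomeomorph.measurableEmbedding]
                refine lintegral_congr fun x => ?_
                rw [← map_sub, L.norm_map, L.norm_map]
            _ = _ := by simp
        · refine Measurable.aemeasurable ?_
          unfold Function.uncurry; fun_prop
        · refine Measurable.lintegral_prod_right' (f := fun p : EuclideanSpace ℝ (Fin n) × EuclideanSpace ℝ (Fin n) => w ‖p.1‖ * K ‖p.1 - ‖ξ‖ • p.2‖) ?_
          fun_prop
    _ = ∫⁻ ξ : EuclideanSpace ℝ (Fin n), ∫⁻ x : EuclideanSpace ℝ (Fin n), F ξ * (w ‖x‖ * K ‖x - ξ‖) := by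
        refine lintegral_congr fun ξ => ?_
        rw [lintegral_const_mul _ (by fun_prop)]
    _ = ∫⁻ x : EuclideanSpace ℝ (Fin n), ∫⁻ ξ : EuclideanSpace ℝ (Fin n), F ξ * (w ‖x‖ * K ‖x - ξ‖) := by
        rw [lintegral_lintegral_swap]
        refine Measurable.aemeasurable ?_
        unfold Function.uncurry; fun_prop
    _ = _ := by
        refine lintegral_congr fun x => ?_
        rw [← lintegral_const_mul _ (by fun_prop)]
        refine lintegral_congr fun ξ => ?_
        ring

lemma aux_pow (n : ℕ) (hn : 3 ≤ n) {y : ℝ} (hy : 0 < y) : y ^ (n - 1) * y ^ (2 - (n : ℝ)) = y := by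
  rw [← Real.rpow_natCast, ← Real.rpow_add hy, Nat.cast_sub (by omega)]
  have : ((n : ℝ) - (1 : ℕ)) + (2 - (n : ℝ)) = 1 := by push_cast; ring
  rw [this, Real.rpow_one]

lemma aux_W_ball (n : ℕ) (hn : 3 ≤ n) :
    IntegrableOn (fun x : EuclideanSpace ℝ (Fin n) => ‖x‖ ^ (2 - (n : ℝ))) (ball 0 1) ∧
    ∫ x in ball (0 : EuclideanSpace ℝ (Fin n)) 1, ‖x‖ ^ (2 - (n : ℝ)) =
      (n : ℝ) / 2 * volume.real (ball (0 : EuclideanSpace ℝ (Fin n)) 1) := by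
  have : Nonempty (Fin n) := ⟨⟨0, by omega⟩⟩
  constructor
  · rw [integrableOn_fun_norm_addHaar volume (f := fun r : ℝ => r ^ (2 - (n : ℝ)))]
    have : IntegrableOn (fun y : ℝ => y) (Ioo 0 1) :=
      (continuous_id.integrableOn_Icc).mono_set Ioo_subset_Icc_self
    refine this.congr_fun ?_ measurableSet_Ioo
    intro y hy
    simp only [finrank_euclideanSpace, Fintype.card_fin, smul_eq_mul]
    rw [aux_pow n hn hy.1]
  · rw [← integral_indicator measurableSet_ball]
    have h := integral_fun_norm_addHaar (volume : Measure (EuclideanSpace ℝ (Fin n)))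
      ((Iio 1).indicator (fun r : ℝ => r ^ (2 - (n : ℝ))))
    have e : ∀ x : EuclideanSpace ℝ (Fin n), (ball (0 : EuclideanSpace ℝ (Fin n)) 1).indicator
        (fun x => ‖x‖ ^ (2 - (n : ℝ))) x = (Iio 1).indicator (fun r : ℝ => r ^ (2 - (n : ℝ))) ‖x‖ := by
      intro x; simp [indicator]
    simp_rw [e]
    rw [h]
    simp only [finrank_euclideanSpace, Fintype.card_fin, smul_eq_mul, nsmul_eq_mul]
    have : ∫ y in Ioi (0:ℝ), y ^ (n - 1) * (Iio 1).indicator (fun r : ℝ => r ^ (2 - (n : ℝ))) y = 1 / 2 := by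
      calc _ = ∫ y in Ioi (0:ℝ), (Iio 1).indicator (fun r : ℝ => r) y := by
            refine setIntegral_congr_fun measurableSet_Ioi fun y (hy : 0 < y) => ?_
            by_cases h : y < 1
            · simp [indicator, h, aux_pow n hn hy]
            · simp [indicator, h]
        _ = _ := by
            rw [integral_indicator measurableSet_Iio, Measure.restrict_restrict measurableSet_Iio,
              Iio_inter_Ioi, ← integral_Ioc_eq_integral_Ioo, ← intervalIntegral.integral_of_le (by norm_num)]
            simp
    rw [this]; ring

lemma aux_nonneg (n : ℕ) (hn : 3 ≤ n) {φ : ℝ → ℝ} (hφ : AntitoneOn φ (Ioi 0))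
    (hW : Integrable (fun x : EuclideanSpace ℝ (Fin n) => ‖x‖ ^ (2 - (n : ℝ)) * φ ‖x‖)) :
    ∀ r, 0 < r → 0 ≤ φ r := by
  have : Nonempty (Fin n) := ⟨⟨0, by omega⟩⟩
  intro r hr
  by_contra! hneg
  rw [integrable_fun_norm_addHaar volume (f := fun r : ℝ => r ^ (2 - (n : ℝ)) * φ r)] at hW
  have h1 : IntegrableOn (fun y : ℝ => y * φ y) (Ioi 0) := by
    refine hW.congr_fun ?_ measurableSet_Ioi
    intro y (hy : 0 < y)
    simp only [finrank_euclideanSpace, Fintype.card_fin, smul_eq_mul]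
    rw [← mul_assoc, aux_pow n hn hy]
  have h2 : IntegrableOn (fun y : ℝ => y * φ y) (Ioi r) := h1.mono_set (Ioi_subset_Ioi hr.le)
  have h3 : IntegrableOn (fun y : ℝ => y ^ (1 : ℝ)) (Ioi r) := by
    have h4 := h2.const_mul (φ r)⁻¹
    refine Integrable.mono' h4 (by fun_prop) ?_
    filter_upwards [self_mem_ae_restrict measurableSet_Ioi] with y hy
    have hy0 : 0 < y := hr.trans hy
    have h5 : φ y ≤ φ r := hφ hr hy0 (le_of_lt hy)
    rw [Real.rpow_one, Real.norm_eq_abs, abs_of_pos hy0]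
    have : 1 ≤ (φ r)⁻¹ * φ y := by
      rw [← div_eq_inv_mul]; exact (one_le_div_of_neg hneg).2 h5
    nlinarith
  rw [integrableOn_Ioi_rpow_iff hr] at h3
  norm_num at h3

lemma aux_comp (n : ℕ) (hn : 3 ≤ n) {φ : ℝ → ℝ} (hφ : AntitoneOn φ (Ioi 0))
    (hW : Integrable (fun x : EuclideanSpace ℝ (Fin n) => ‖x‖ ^ (2 - (n : ℝ)) * φ ‖x‖))
    (hB : IntegrableOn (fun x : EuclideanSpace ℝ (Fin n) => φ ‖x‖) (ball 0 1)) :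
    0 ≤ ∫ x : EuclideanSpace ℝ (Fin n), ‖x‖ ^ (2 - (n : ℝ)) * φ ‖x‖ ∧
    (n : ℝ) / 2 * ∫ x in ball (0 : EuclideanSpace ℝ (Fin n)) 1, φ ‖x‖ ≤
      ∫ x : EuclideanSpace ℝ (Fin n), ‖x‖ ^ (2 - (n : ℝ)) * φ ‖x‖ := by
  have : Nonempty (Fin n) := ⟨⟨0, by omega⟩⟩
  have hn3 : (3 : ℝ) ≤ n := by exact_mod_cast hn
  have hpos := aux_nonneg n hn hφ hW
  obtain ⟨hI, hV⟩ := aux_W_ball n hn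
  have hae : ∀ᵐ x : EuclideanSpace ℝ (Fin n), x ≠ 0 :=
    compl_mem_ae_iff.2 (measure_singleton (0 : EuclideanSpace ℝ (Fin n)))
  have hnn : ∀ᵐ x : EuclideanSpace ℝ (Fin n), 0 ≤ ‖x‖ ^ (2 - (n : ℝ)) * φ ‖x‖ := by
    filter_upwards [hae] with x hx
    exact mul_nonneg (by positivity) (hpos _ (norm_pos_iff.2 hx))
  refine ⟨integral_nonneg_of_ae hnn, ?_⟩
  refine le_trans ?_ (setIntegral_le_integral (s := ball 0 1) hW hnn)
  set s : ℝ := ((n : ℝ) / 2) ^ (2 - (n : ℝ))⁻¹ with hs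
  have hs0 : 0 < s := by positivity
  have hsn : s ^ (2 - (n : ℝ)) = (n : ℝ) / 2 := by
    rw [hs, ← Real.rpow_mul (by positivity), inv_mul_cancel₀ (by linarith), Real.rpow_one]
  have h1 : 0 ≤ ∫ x in ball (0 : EuclideanSpace ℝ (Fin n)) 1,
      (‖x‖ ^ (2 - (n : ℝ)) - n / 2) * (φ ‖x‖ - φ s) := by
    refine integral_nonneg_of_ae ?_
    filter_upwards [ae_restrict_of_ae hae] with x hx
    have hx0 : 0 < ‖x‖ := norm_pos_iff.2 hx
    rw [← hsn]
    rcases le_total ‖x‖ s with h | h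
    · refine mul_nonneg (sub_nonneg.2 ?_) (sub_nonneg.2 (hφ hx0 hs0 h))
      exact Real.rpow_le_rpow_of_nonpos hx0 h (by linarith)
    · refine mul_nonneg_of_nonpos_of_nonpos (sub_nonpos.2 ?_) (sub_nonpos.2 (hφ hs0 hx0 h))
      exact Real.rpow_le_rpow_of_nonpos hs0 h (by linarith)
  have e : ∀ x : EuclideanSpace ℝ (Fin n), (‖x‖ ^ (2 - (n : ℝ)) - n / 2) * (φ ‖x‖ - φ s) =
      (‖x‖ ^ (2 - (n : ℝ)) * φ ‖x‖ - n / 2 * φ ‖x‖) - (φ s * ‖x‖ ^ (2 - (n : ℝ)) - φ s * (n / 2)) := by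
    intro x; ring
  simp_rw [e] at h1
  have hc : IntegrableOn (fun _ : EuclideanSpace ℝ (Fin n) => φ s * ((n : ℝ) / 2)) (ball 0 1) :=
    integrableOn_const measure_ball_lt_top.ne
  have hA1 : IntegrableOn (fun x : EuclideanSpace ℝ (Fin n) =>
      ‖x‖ ^ (2 - (n : ℝ)) * φ ‖x‖ - n / 2 * φ ‖x‖) (ball 0 1) :=
    hW.integrableOn.sub (hB.const_mul _)
  have hA2 : IntegrableOn (fun x : EuclideanSpace ℝ (Fin n) =>
      φ s * ‖x‖ ^ (2 - (n : ℝ)) - φ s * (n / 2)) (ball 0 1) :=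
    (hI.const_mul _).sub hc
  rw [integral_sub hA1 hA2,
    integral_sub hW.integrableOn (hB.const_mul _), integral_sub (hI.const_mul _) hc,
    integral_const_mul, integral_const_mul, hV, setIntegral_const, smul_eq_mul] at h1
  linarith

noncomputable def auxG (n : ℕ) (β : ℝ) (A : Set (EuclideanSpace ℝ (Fin n)))
    (x : EuclideanSpace ℝ (Fin n)) : ℝ≥0∞ :=
  ∫⁻ ξ, A.indicator 1 ξ * ENNReal.ofReal (‖x - ξ‖ ^ (β - n))

noncomputable def auxU (n : ℕ) (β : ℝ) (A : Set (EuclideanSpace ℝ (Fin n))) (r : ℝ) : ℝ :=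
  ∫ ω, (auxG n β A (r • ω)).toReal ∂(auxNu n)

lemma auxG_meas (n : ℕ) (β : ℝ) {A : Set (EuclideanSpace ℝ (Fin n))} (hA : MeasurableSet A) :
    Measurable (auxG n β A) := by
  have h1 : Measurable (A.indicator (1 : EuclideanSpace ℝ (Fin n) → ℝ≥0∞)) :=
    measurable_one.indicator hA
  refine Measurable.lintegral_prod_right' (f := fun p : EuclideanSpace ℝ (Fin n) × EuclideanSpace ℝ (Fin n) =>
    A.indicator 1 p.2 * ENNReal.ofReal (‖p.1 - p.2‖ ^ (β - n))) ?_
  fun_prop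

lemma auxG_bdd (n : ℕ) (hn : 1 ≤ n) {β : ℝ} (hβ : 0 < β) (hβn : β < n)
    {A : Set (EuclideanSpace ℝ (Fin n))} (hA : MeasurableSet A) (hAv : volume A < ∞) :
    ∃ M : ℝ≥0∞, M < ∞ ∧ ∀ x, auxG n β A x ≤ M := by
  have : Nonempty (Fin n) := ⟨⟨0, by omega⟩⟩
  have hI : IntegrableOn (fun x : EuclideanSpace ℝ (Fin n) => ‖x‖ ^ (β - (n : ℝ))) (ball 0 1) := by
    rw [integrableOn_fun_norm_addHaar volume (f := fun r : ℝ => r ^ (β - (n : ℝ)))]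
    have : IntegrableOn (fun y : ℝ => y ^ (β - 1)) (Ioo 0 1) := by
      rw [← intervalIntegrable_iff_integrableOn_Ioo_of_le (by norm_num)]
      exact intervalIntegral.intervalIntegrable_rpow' (by linarith)
    refine this.congr_fun ?_ measurableSet_Ioo
    intro y hy
    simp only [finrank_euclideanSpace, Fintype.card_fin, smul_eq_mul]
    rw [← Real.rpow_natCast, ← Real.rpow_add hy.1, Nat.cast_sub hn]
    congr 1; push_cast; ring
  set M0 : ℝ≥0∞ := ∫⁻ x in ball (0 : EuclideanSpace ℝ (Fin n)) 1, ENNReal.ofReal (‖x‖ ^ (β - (n : ℝ)))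
    with hM0
  have hM0f : M0 < ∞ := by
    have := hI.lintegral_lt_top
    exact this
  refine ⟨volume A + M0, ENNReal.add_lt_top.2 ⟨hAv, hM0f⟩, fun x => ?_⟩
  have h1 : ∀ ξ, A.indicator 1 ξ * ENNReal.ofReal (‖x - ξ‖ ^ (β - n)) ≤
      A.indicator 1 ξ + (ball (0 : EuclideanSpace ℝ (Fin n)) 1).indicator
        (fun z => ENNReal.ofReal (‖z‖ ^ (β - (n : ℝ)))) (x - ξ) := by
    intro ξ
    by_cases hξ : ξ ∈ A
    · by_cases hb : ‖x - ξ‖ < 1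
      · simp [indicator, hξ, hb]
      · have : ‖x - ξ‖ ^ (β - n) ≤ 1 :=
          Real.rpow_le_one_of_one_le_of_nonpos (not_lt.1 hb) (by linarith)
        simpa [indicator, hξ, hb] using this
    · simp [hξ]
  unfold auxG
  refine (lintegral_mono h1).trans ?_
  rw [lintegral_add_left (measurable_one.indicator hA), lintegral_indicator_one hA,
    lintegral_sub_left_eq_self (fun z => (ball (0 : EuclideanSpace ℝ (Fin n)) 1).indicator
        (fun z => ENNReal.ofReal (‖z‖ ^ (β - (n : ℝ)))) z) x,
    lintegral_indicator measurableSet_ball]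

lemma auxG_real (n : ℕ) (hn : 1 ≤ n) {β : ℝ} (hβ : 0 < β) (hβn : β < n)
    {A : Set (EuclideanSpace ℝ (Fin n))} (hA : MeasurableSet A) (hAv : volume A < ∞)
    (x : EuclideanSpace ℝ (Fin n)) :
    Integrable (fun ξ => A.indicator (1 : EuclideanSpace ℝ (Fin n) → ℝ) ξ * ‖x - ξ‖ ^ (β - (n : ℝ))) ∧
    ∫ ξ, A.indicator (1 : EuclideanSpace ℝ (Fin n) → ℝ) ξ * ‖x - ξ‖ ^ (β - (n : ℝ)) =
      (auxG n β A x).toReal := by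
  obtain ⟨M, hM, hb⟩ := auxG_bdd n hn hβ hβn hA hAv
  have hm : Measurable (fun ξ => A.indicator (1 : EuclideanSpace ℝ (Fin n) → ℝ) ξ * ‖x - ξ‖ ^ (β - (n : ℝ))) := by
    have : Measurable (A.indicator (1 : EuclideanSpace ℝ (Fin n) → ℝ)) := measurable_one.indicator hA
    fun_prop
  have hnn : ∀ ξ, 0 ≤ A.indicator (1 : EuclideanSpace ℝ (Fin n) → ℝ) ξ * ‖x - ξ‖ ^ (β - (n : ℝ)) := by
    intro ξ
    exact mul_nonneg (indicator_nonneg (fun _ _ => by simp) _) (by positivity)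
  have he : ∫⁻ ξ, ENNReal.ofReal (A.indicator (1 : EuclideanSpace ℝ (Fin n) → ℝ) ξ * ‖x - ξ‖ ^ (β - (n : ℝ))) =
      auxG n β A x := by
    refine lintegral_congr fun ξ => ?_
    by_cases hξ : ξ ∈ A <;> simp [hξ]
  constructor
  · refine ⟨hm.aestronglyMeasurable, ?_⟩
    rw [hasFiniteIntegral_iff_ofReal (Filter.Eventually.of_forall hnn), he]
    exact (hb x).trans_lt hM
  · rw [integral_eq_lintegral_of_nonneg_ae (Filter.Eventually.of_forall hnn) hm.aestronglyMeasurable, he]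

lemma aux_rieszPot (n : ℕ) (hn : 1 ≤ n) {β : ℝ} (hβ : 0 < β) (hβn : β < n)
    {E : Set (EuclideanSpace ℝ (Fin n))} (hE : MeasurableSet E) (hEv : volume E < ∞)
    (x : EuclideanSpace ℝ (Fin n)) :
    rieszPot β (fE E) x = rieszConst n β * ((auxG n β (ball 0 1) x).toReal - (auxG n β E x).toReal) := by
  obtain ⟨h1, h2⟩ := auxG_real n hn hβ hβn (A := ball 0 1) measurableSet_ball measure_ball_lt_top x
  obtain ⟨h3, h4⟩ := auxG_real n hn hβ hβn hE hEv x
  unfold rieszPot fE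
  simp_rw [sub_mul]
  rw [integral_sub h1 h3, h2, h4]

lemma auxG_intNu (n : ℕ) (hn : 1 ≤ n) {β : ℝ} (hβ : 0 < β) (hβn : β < n)
    {A : Set (EuclideanSpace ℝ (Fin n))} (hA : MeasurableSet A) (hAv : volume A < ∞) (r : ℝ) :
    Integrable (fun ω => (auxG n β A (r • ω)).toReal) (auxNu n) := by
  have := auxNu_prob n hn
  obtain ⟨M, hM, hb⟩ := auxG_bdd n hn hβ hβn hA hAv
  have hm := auxG_meas n β hA
  have hm' : Measurable (fun ω : EuclideanSpace ℝ (Fin n) => (auxG n β A (r • ω)).toReal) := by fun_prop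
  refine Integrable.of_bound (C := M.toReal) hm'.aestronglyMeasurable (Filter.Eventually.of_forall fun ω => ?_)
  rw [Real.norm_of_nonneg ENNReal.toReal_nonneg]
  exact ENNReal.toReal_mono hM.ne (hb _)

lemma auxU_nonneg (n : ℕ) (β : ℝ) (A : Set (EuclideanSpace ℝ (Fin n))) (r : ℝ) : 0 ≤ auxU n β A r :=
  integral_nonneg fun _ => ENNReal.toReal_nonneg

lemma auxU_meas (n : ℕ) (hn : 1 ≤ n) (β : ℝ) {A : Set (EuclideanSpace ℝ (Fin n))} (hA : MeasurableSet A) :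
    Measurable (auxU n β A) := by
  have := auxNu_prob n hn
  have hm := auxG_meas n β hA
  have hp : StronglyMeasurable (fun p : ℝ × EuclideanSpace ℝ (Fin n) => (auxG n β A (p.1 • p.2)).toReal) :=
    Measurable.stronglyMeasurable (by fun_prop)
  exact (hp.integral_prod_right' (ν := auxNu n)).measurable

lemma auxU_lint (n : ℕ) (hn : 1 ≤ n) {β : ℝ} (hβ : 0 < β) (hβn : β < n)
    {A : Set (EuclideanSpace ℝ (Fin n))} (hA : MeasurableSet A) (hAv : volume A < ∞)
    {w : ℝ → ℝ≥0∞} (hw : Measurable w) :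
    ∫⁻ x : EuclideanSpace ℝ (Fin n), w ‖x‖ * ENNReal.ofReal (auxU n β A ‖x‖) =
      ∫⁻ x, w ‖x‖ * auxG n β A x := by
  obtain ⟨M, hM, hb⟩ := auxG_bdd n hn hβ hβn hA hAv
  have h := aux_radial n hn (K := fun r => ENNReal.ofReal (r ^ (β - (n : ℝ)))) (by fun_prop) hw
    (F := A.indicator 1) (measurable_one.indicator hA)
  refine Eq.trans (lintegral_congr fun x => ?_) h
  congr 1
  unfold auxU
  rw [ofReal_integral_eq_lintegral_ofReal (auxG_intNu n hn hβ hβn hA hAv _)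
    (Filter.Eventually.of_forall fun _ => ENNReal.toReal_nonneg)]
  refine lintegral_congr fun ω => ?_
  rw [ENNReal.ofReal_toReal ((hb _).trans_lt hM).ne]
  rfl

lemma auxU_W (n : ℕ) (hn : 3 ≤ n) {α : ℝ} (hα : 0 < α) (hαn : α + 2 < n)
    {A : Set (EuclideanSpace ℝ (Fin n))} (hA : MeasurableSet A) (hAv : volume A < ∞) :
    Integrable (fun x : EuclideanSpace ℝ (Fin n) => ‖x‖ ^ (2 - (n : ℝ)) * auxU n α A ‖x‖) ∧
    rieszConst n 2 * rieszConst n α *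
      ∫ x : EuclideanSpace ℝ (Fin n), ‖x‖ ^ (2 - (n : ℝ)) * auxU n α A ‖x‖ =
      rieszConst n (α + 2) * (auxG n (α + 2) A 0).toReal := by
  have : Nonempty (Fin n) := ⟨⟨0, by omega⟩⟩
  have hn3 : (3 : ℝ) ≤ n := by exact_mod_cast hn
  have hc2 := aux_rieszConst_pos n (β := 2) (by norm_num) (by linarith)
  have hca := aux_rieszConst_pos n (β := α) hα (by linarith)
  have hca2 := aux_rieszConst_pos n (β := α + 2) (by linarith) (by linarith)
  obtain ⟨M, hM, hb⟩ := auxG_bdd n (by omega) (β := α + 2) (by linarith) hαn hA hAv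
  have hind : Measurable (A.indicator (1 : EuclideanSpace ℝ (Fin n) → ℝ≥0∞)) := measurable_one.indicator hA
  have h1 := auxU_lint n (by omega) hα (by linarith) hA hAv
    (w := fun r => ENNReal.ofReal (r ^ (2 - (n : ℝ)))) (by fun_prop)
  have h2 : ENNReal.ofReal (rieszConst n 2 * rieszConst n α) *
      ∫⁻ x : EuclideanSpace ℝ (Fin n), ENNReal.ofReal (‖x‖ ^ (2 - (n : ℝ))) * auxG n α A x =
      ENNReal.ofReal (rieszConst n (α + 2)) * auxG n (α + 2) A 0 := by
    calc _ = ENNReal.ofReal (rieszConst n 2 * rieszConst n α) *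
          ∫⁻ x : EuclideanSpace ℝ (Fin n), ∫⁻ ξ, A.indicator 1 ξ * (ENNReal.ofReal (‖x‖ ^ (2 - (n : ℝ))) *
            ENNReal.ofReal (‖x - ξ‖ ^ (α - n))) := by
          congr 1
          refine lintegral_congr fun x => ?_
          unfold auxG
          rw [← lintegral_const_mul _ (by fun_prop)]
          refine lintegral_congr fun ξ => ?_
          ring
      _ = ∫⁻ ξ : EuclideanSpace ℝ (Fin n), A.indicator 1 ξ * (ENNReal.ofReal (rieszConst n 2 * rieszConst n α) *
          ∫⁻ x : EuclideanSpace ℝ (Fin n), ENNReal.ofReal (‖x‖ ^ (2 - (n : ℝ))) *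
            ENNReal.ofReal (‖x - ξ‖ ^ (α - n))) := by
          rw [lintegral_lintegral_swap, ← lintegral_const_mul' _ _ ENNReal.ofReal_ne_top]
          · refine lintegral_congr fun ξ => ?_
            rw [lintegral_const_mul _ (by fun_prop)]
            ring
          · refine Measurable.aemeasurable ?_
            unfold Function.uncurry; fun_prop
      _ = ∫⁻ ξ : EuclideanSpace ℝ (Fin n), ENNReal.ofReal (rieszConst n (α + 2)) * (A.indicator 1 ξ *
            ENNReal.ofReal (‖0 - ξ‖ ^ (α + 2 - n))) := by
          refine lintegral_congr_ae ?_
          filter_upwards [compl_mem_ae_iff.2 (measure_singleton (0 : EuclideanSpace ℝ (Fin n)))] with ξ hξ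
          rw [aux_semigroup n (by omega) hα hαn ξ hξ, ENNReal.ofReal_mul hca2.le, zero_sub, norm_neg]
          ring
      _ = _ := by
          rw [lintegral_const_mul' _ _ ENNReal.ofReal_ne_top]
          rfl
  have hm := auxU_meas n (by omega) α hA
  have hnn : ∀ x : EuclideanSpace ℝ (Fin n), 0 ≤ ‖x‖ ^ (2 - (n : ℝ)) * auxU n α A ‖x‖ :=
    fun x => mul_nonneg (by positivity) (auxU_nonneg _ _ _ _)
  have he : ∫⁻ x : EuclideanSpace ℝ (Fin n), ENNReal.ofReal (‖x‖ ^ (2 - (n : ℝ)) * auxU n α A ‖x‖) =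
      ∫⁻ x, ENNReal.ofReal (‖x‖ ^ (2 - (n : ℝ))) * auxG n α A x := by
    rw [← h1]
    refine lintegral_congr fun x => ?_
    rw [ENNReal.ofReal_mul (by positivity)]
  have hmm : Measurable (fun x : EuclideanSpace ℝ (Fin n) => ‖x‖ ^ (2 - (n : ℝ)) * auxU n α A ‖x‖) := by
    fun_prop
  constructor
  · refine ⟨hmm.aestronglyMeasurable, ?_⟩
    rw [hasFiniteIntegral_iff_ofReal (Filter.Eventually.of_forall hnn), he]
    by_contra hcon
    rw [not_lt, top_le_iff] at hcon
    rw [hcon, ENNReal.mul_top (by simpa using mul_pos hc2 hca)] at h2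
    exact (ENNReal.mul_lt_top ENNReal.ofReal_lt_top ((hb 0).trans_lt hM)).ne h2.symm
  · rw [integral_eq_lintegral_of_nonneg_ae (Filter.Eventually.of_forall hnn) hmm.aestronglyMeasurable, he]
    have := congrArg ENNReal.toReal h2
    rw [ENNReal.toReal_mul, ENNReal.toReal_mul, ENNReal.toReal_ofReal (by positivity),
      ENNReal.toReal_ofReal hca2.le] at this
    exact this

lemma auxU_ball (n : ℕ) (hn : 1 ≤ n) {α : ℝ} (hα : 0 < α) (hαn : α < n)
    {A : Set (EuclideanSpace ℝ (Fin n))} (hA : MeasurableSet A) (hAv : volume A < ∞) :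
    IntegrableOn (fun x : EuclideanSpace ℝ (Fin n) => auxU n α A ‖x‖) (ball 0 1) ∧
    IntegrableOn (fun x : EuclideanSpace ℝ (Fin n) => (auxG n α A x).toReal) (ball 0 1) ∧
    ∫ x in ball (0 : EuclideanSpace ℝ (Fin n)) 1, auxU n α A ‖x‖ =
      ∫ x in ball (0 : EuclideanSpace ℝ (Fin n)) 1, (auxG n α A x).toReal := by
  obtain ⟨M, hM, hb⟩ := auxG_bdd n hn hα hαn hA hAv
  have hm := auxU_meas n hn α hA
  have hg := auxG_meas n α hA
  have hmm : Measurable (fun x : EuclideanSpace ℝ (Fin n) => auxU n α A ‖x‖) := by fun_prop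
  have hgg : Measurable (fun x : EuclideanSpace ℝ (Fin n) => (auxG n α A x).toReal) := by fun_prop
  have h1 := auxU_lint n hn hα hαn hA hAv
    (w := (Iio 1).indicator 1) (measurable_one.indicator measurableSet_Iio)
  have e : ∀ (H : EuclideanSpace ℝ (Fin n) → ℝ≥0∞),
      ∫⁻ x, (Iio (1:ℝ)).indicator 1 ‖x‖ * H x = ∫⁻ x in ball 0 1, H x := by
    intro H
    rw [← lintegral_indicator measurableSet_ball]
    refine lintegral_congr fun x => ?_
    by_cases h : ‖x‖ < 1 <;> simp [indicator, h]
  rw [e (fun x => ENNReal.ofReal (auxU n α A ‖x‖)), e] at h1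
  have h2 : ∫⁻ x in ball (0 : EuclideanSpace ℝ (Fin n)) 1, ENNReal.ofReal (auxG n α A x).toReal =
      ∫⁻ x in ball (0 : EuclideanSpace ℝ (Fin n)) 1, auxG n α A x := by
    refine lintegral_congr fun x => ?_
    rw [ENNReal.ofReal_toReal ((hb _).trans_lt hM).ne]
  have hfin : ∫⁻ x in ball (0 : EuclideanSpace ℝ (Fin n)) 1, auxG n α A x < ∞ := by
    refine (lintegral_mono hb).trans_lt ?_
    rw [setLIntegral_const]
    exact ENNReal.mul_lt_top hM measure_ball_lt_top
  refine ⟨⟨hmm.aestronglyMeasurable, ?_⟩, ⟨hgg.aestronglyMeasurable, ?_⟩, ?_⟩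
  · rw [hasFiniteIntegral_iff_ofReal (Filter.Eventually.of_forall fun x => auxU_nonneg _ _ _ _), h1]
    exact hfin
  · rw [hasFiniteIntegral_iff_ofReal (Filter.Eventually.of_forall fun x => ENNReal.toReal_nonneg), h2]
    exact hfin
  · rw [integral_eq_lintegral_of_nonneg_ae (Filter.Eventually.of_forall fun x => auxU_nonneg _ _ _ _)
      hmm.aestronglyMeasurable, integral_eq_lintegral_of_nonneg_ae
      (Filter.Eventually.of_forall fun x => ENNReal.toReal_nonneg) hgg.aestronglyMeasurable, h1, h2]

lemma aux_const (n : ℕ) (hn : 3 ≤ n) :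
    (volume.real (ball (0 : EuclideanSpace ℝ (Fin n)) 1))⁻¹ = n * (n - 2) * rieszConst n 2 := by
  have : Nonempty (Fin n) := ⟨⟨0, by omega⟩⟩
  have hn3 : (3 : ℝ) ≤ n := by exact_mod_cast hn
  have hG : 0 < Real.Gamma ((n : ℝ) / 2 - 1) := Real.Gamma_pos_of_pos (by linarith)
  have hG2 : Real.Gamma ((n : ℝ) / 2 + 1) = n / 2 * ((n / 2 - 1) * Real.Gamma ((n : ℝ) / 2 - 1)) := by
    rw [Real.Gamma_add_one (by positivity)]
    congr 1
    have := Real.Gamma_add_one (s := (n : ℝ) / 2 - 1) (by linarith)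
    rwa [sub_add_cancel] at this
  have hpi : Real.sqrt Real.pi ^ n = Real.pi ^ ((n : ℝ) / 2) := by
    rw [Real.sqrt_eq_rpow, ← Real.rpow_natCast, ← Real.rpow_mul Real.pi_pos.le]
    congr 1; ring
  have hp : 0 < Real.pi ^ ((n : ℝ) / 2) := by positivity
  have hq : (0 : ℝ) < n / 2 * ((n / 2 - 1) * Real.Gamma ((n : ℝ) / 2 - 1)) := by
    have : (0 : ℝ) < n / 2 - 1 := by linarith
    positivity
  rw [measureReal_def, EuclideanSpace.volume_ball]
  simp only [Fintype.card_fin, ENNReal.ofReal_one, one_pow, one_mul]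
  rw [hG2, hpi, ENNReal.toReal_ofReal (by positivity)]
  unfold rieszConst
  rw [show ((n : ℝ) - 2) / 2 = n / 2 - 1 by ring]
  norm_num
  field_simp
  ring

/-- If the spherical averages of `I_α f_E` are nonincreasing, then the mean of
`I_α f_E` over `B_1` is controlled by the value of `I_{α+2} f_E` at the origin. -/
theorem statement11 (n : ℕ) (hn : 5 ≤ n) (α : ℝ) (hα : α ∈ Set.Icc 2 ((n : ℝ) - 3))
    (E : Set (EuclideanSpace ℝ (Fin n))) (hE : HasFinitePerimeter E)
    (hvol : volume E = volume (ball (0 : EuclideanSpace ℝ (Fin n)) 1))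
    (hmono : AntitoneOn (sphAvg (rieszPot α (fE E))) (Set.Ioi 0)) :
    ballAvg (rieszPot α (fE E)) 1 ≤ 2 * (n : ℝ) * rieszPot (α + 2) (fE E) 0 := by
  obtain ⟨hα2, hαn⟩ := hα
  have hn5 : (5 : ℝ) ≤ n := by exact_mod_cast hn
  have hEm := hE.1
  have hEv : volume E < ⊤ := by rw [hvol]; exact measure_ball_lt_top
  have hBm : MeasurableSet (ball (0 : EuclideanSpace ℝ (Fin n)) 1) := measurableSet_ball
  have hBv : volume (ball (0 : EuclideanSpace ℝ (Fin n)) 1) < ⊤ := measure_ball_lt_top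
  have hα0 : 0 < α := by linarith
  have hαn' : α < n := by linarith
  set φ : ℝ → ℝ := fun r => rieszConst n α * (auxU n α (ball 0 1) r - auxU n α E r) with hφdef
  have hφ : AntitoneOn φ (Ioi 0) := by
    refine hmono.congr ?_
    intro r hr
    rw [aux_sphAvg n (by omega) _ hr]
    simp_rw [aux_rieszPot n (by omega) hα0 hαn' hEm hEv]
    rw [integral_const_mul, integral_sub (auxG_intNu n (by omega) hα0 hαn' hBm hBv r)
      (auxG_intNu n (by omega) hα0 hαn' hEm hEv r)]
    rfl
  obtain ⟨hWB, hWB'⟩ := auxU_W n (by omega) hα0 (by linarith) hBm hBv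
  obtain ⟨hWE, hWE'⟩ := auxU_W n (by omega) hα0 (by linarith) hEm hEv
  obtain ⟨hB1, hB2, hB3⟩ := auxU_ball n (by omega) hα0 hαn' hBm hBv
  obtain ⟨hE1, hE2, hE3⟩ := auxU_ball n (by omega) hα0 hαn' hEm hEv
  have eW : ∀ x : EuclideanSpace ℝ (Fin n), ‖x‖ ^ (2 - (n : ℝ)) * φ ‖x‖ =
      rieszConst n α * (‖x‖ ^ (2 - (n : ℝ)) * auxU n α (ball 0 1) ‖x‖ -
        ‖x‖ ^ (2 - (n : ℝ)) * auxU n α E ‖x‖) := by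
    intro x; rw [hφdef]; ring
  have hW : Integrable (fun x : EuclideanSpace ℝ (Fin n) => ‖x‖ ^ (2 - (n : ℝ)) * φ ‖x‖) := by
    simp_rw [eW]
    exact (hWB.sub hWE).const_mul _
  have hBB : IntegrableOn (fun x : EuclideanSpace ℝ (Fin n) => φ ‖x‖) (ball 0 1) :=
    (hB1.sub hE1).const_mul _
  obtain ⟨hT0, hT⟩ := aux_comp n (by omega) hφ hW hBB
  have hT1 : rieszPot (α + 2) (fE E) 0 =
      rieszConst n 2 * ∫ x : EuclideanSpace ℝ (Fin n), ‖x‖ ^ (2 - (n : ℝ)) * φ ‖x‖ := by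
    rw [aux_rieszPot n (by omega) (by linarith) (by linarith) hEm hEv]
    simp_rw [eW]
    rw [integral_const_mul, integral_sub hWB hWE]
    linear_combination hWE' - hWB'
  have hA : ballAvg (rieszPot α (fE E)) 1 =
      (volume.real (ball (0 : EuclideanSpace ℝ (Fin n)) 1))⁻¹ *
        ∫ x in ball (0 : EuclideanSpace ℝ (Fin n)) 1, φ ‖x‖ := by
    unfold ballAvg
    simp_rw [aux_rieszPot n (by omega) hα0 hαn' hEm hEv]
    rw [← measureReal_def, hφdef, integral_const_mul, integral_const_mul, integral_sub hB2 hE2,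
      integral_sub hB1 hE1, hB3, hE3]
  have hc2 := aux_rieszConst_pos n (β := 2) (by norm_num) (by linarith)
  rw [hA, hT1, aux_const n (by omega)]
  set T := ∫ x : EuclideanSpace ℝ (Fin n), ‖x‖ ^ (2 - (n : ℝ)) * φ ‖x‖
  set S := ∫ x in ball (0 : EuclideanSpace ℝ (Fin n)) 1, φ ‖x‖
  have h1 : 0 ≤ (n - 2) * rieszConst n 2 := mul_nonneg (by linarith) hc2.le
  have h2 := mul_le_mul_of_nonneg_left hT h1
  have h3 : 0 ≤ rieszConst n 2 * T := mul_nonneg hc2.le hT0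
  nlinarith
end
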